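/- arXiv:2005.02798 — 4 statements merged into one kernel-verified Lean document; each statement's English description precedes it below -/
import Mathlib

section
/- Let K : S² × S² → ℂ be a continuous Hermitian kernel with spherical-harmonic expansion coefficients a_{ℓ,ℓ'} and associated operator A. Then K is positive definite if and only if A is a positive operator on ℓ², i.e. ⟨A(y),y⟩ ≥ 0 for all y ∈ ℓ². -/
open scoped ComplexOrder
open Polynomial

noncomputable section

/-- The unit 2-sphere `S² ⊆ ℝ³`. -/
abbrev S2 := Metric.sphere (0 : EuclideanSpace ℝ (Fin 3)) 1

/-- The Legendre polynomial of degree `j` (Rodrigues' formula), normalized so that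
`P j 1 = 1`. -/
noncomputable def legP (j : ℕ) : Polynomial ℝ :=
  Polynomial.C (1 / ((2 : ℝ) ^ j * (j.factorial : ℝ))) *
    (Polynomial.derivative^[j] ((Polynomial.X ^ 2 - 1) ^ j))

/-- The associated Legendre function `P_{j,m}` for nonnegative order `m`. -/
noncomputable def assocLegNat (j m : ℕ) (x : ℝ) : ℝ :=
  (-1 : ℝ) ^ m * Real.sqrt (1 - x ^ 2) ^ m *
    (Polynomial.derivative^[m] (legP j)).eval x

/-- The associated Legendre function `P_{j,k}` for integer order `k`,
with `P_{j,-m} = (-1)^m (j-m)!/(j+m)! P_{j,m}`. -/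
noncomputable def assocLeg (j : ℕ) (k : ℤ) (x : ℝ) : ℝ :=
  if 0 ≤ k then assocLegNat j k.toNat x
  else (-1 : ℝ) ^ (-k).toNat *
    (((j - (-k).toNat).factorial : ℝ) / ((j + (-k).toNat).factorial : ℝ)) *
    assocLegNat j (-k).toNat x

/-- The complex spherical harmonic `Y_j^k`, expressed through the Cartesian
coordinates of a point `ξ` of the sphere: the polar angle `θ` satisfies
`cos θ = ξ₃`, and the azimuth `φ` is the argument of `ξ₁ + i ξ₂`, so that
`Y_j^k(ξ) = (1/√(2π)) √((2j+1)/2 · (j−k)!/(j+k)!) · P_{j,k}(cos θ) · e^{ikφ}`. -/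
noncomputable def sphY (j : ℕ) (k : ℤ) (ξ : S2) : ℂ :=
  ((1 / Real.sqrt (2 * Real.pi) *
      Real.sqrt ((2 * (j : ℝ) + 1) / 2 *
        ((((j : ℤ) - k).toNat.factorial : ℝ) / (((j : ℤ) + k).toNat.factorial : ℝ))) *
      assocLeg j k ((ξ : EuclideanSpace ℝ (Fin 3)) 2) : ℝ) : ℂ) *
    Complex.exp (Complex.I * (k : ℂ) *
      ((Complex.arg ((((ξ : EuclideanSpace ℝ (Fin 3)) 0 : ℝ) : ℂ) +
        (((ξ : EuclideanSpace ℝ (Fin 3)) 1 : ℝ) : ℂ) * Complex.I) : ℝ) : ℂ))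

/-- Single-index enumeration `(F_ℓ)` of the spherical harmonics: `sphF n = Y_j^k`
with `n = j² + j + k`, `j = ⌊√n⌋`, i.e. the paper's numbering `F_{j²+j+1+k} = Y_j^k`
(indices shifted by one so that `sphF n = F_{n+1}`). -/
noncomputable def sphF (n : ℕ) : S2 → ℂ :=
  sphY n.sqrt ((n : ℤ) - n.sqrt ^ 2 - n.sqrt)

/-- A kernel on the sphere is positive definite if each of its quadratic forms on a
nonempty finite set of (distinct) points is nonnegative. -/
def IsPosDefKer (K : S2 → S2 → ℂ) : Prop :=
  ∀ Ξ : Finset S2, Ξ.Nonempty → ∀ c : S2 → ℂ,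
    0 ≤ ∑ ξ ∈ Ξ, ∑ ζ ∈ Ξ, c ξ * (starRingEnd ℂ) (c ζ) * K ξ ζ

/-- A kernel on the sphere is strictly positive definite if each of its quadratic
forms on a nonempty finite set of (distinct) points, with coefficients not all zero,
is positive. -/
def IsStrictPosDefKer (K : S2 → S2 → ℂ) : Prop :=
  ∀ Ξ : Finset S2, Ξ.Nonempty → ∀ c : S2 → ℂ, (∃ ξ ∈ Ξ, c ξ ≠ 0) →
    0 < ∑ ξ ∈ Ξ, ∑ ζ ∈ Ξ, c ξ * (starRingEnd ℂ) (c ζ) * K ξ ζ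

/-- The matrix `D_j = (d_j(k,k'))_{k,k'=-j}^j` of a block kernel. -/
def Dmat (d : ℕ → ℤ → ℤ → ℂ) (j : ℕ) : Matrix (Fin (2 * j + 1)) (Fin (2 * j + 1)) ℂ :=
  fun k k' => d j ((k : ℤ) - j) ((k' : ℤ) - j)

/-- `K` has the pointwise convergent block spherical harmonic expansion
`K(ξ,ζ) = Σ_{j=0}^∞ Σ_{k=-j}^j Σ_{k'=-j}^j d_j(k,k') Y_j^k(ξ) conj(Y_j^{k'}(ζ))`. -/
def HasBlockExpansion (K : S2 → S2 → ℂ) (d : ℕ → ℤ → ℤ → ℂ) : Prop :=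
  ∀ ξ ζ : S2, HasSum (fun j : ℕ =>
    ∑ k ∈ Finset.Icc (-(j : ℤ)) j, ∑ k' ∈ Finset.Icc (-(j : ℤ)) j,
      d j k k' * sphY j k ξ * (starRingEnd ℂ) (sphY j k' ζ)) (K ξ ζ)

section Legendre

open intervalIntegral

lemma integral_derivative_eval (p : ℝ[X]) (a b : ℝ) :
    ∫ x in a..b, (derivative p).eval x = p.eval b - p.eval a :=
  integral_eq_sub_of_hasDerivAt (fun x _ => p.hasDerivAt x)
    ((derivative p).continuous.intervalIntegrable _ _)

lemma integral_eval_add (p q : ℝ[X]) (a b : ℝ) :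
    ∫ x in a..b, (p + q).eval x = (∫ x in a..b, p.eval x) + ∫ x in a..b, q.eval x := by
  simp only [eval_add]
  exact integral_add (p.continuous.intervalIntegrable _ _) (q.continuous.intervalIntegrable _ _)

lemma integral_eval_C_mul (c : ℝ) (p : ℝ[X]) (a b : ℝ) :
    ∫ x in a..b, (C c * p).eval x = c * ∫ x in a..b, p.eval x := by
  simp only [eval_mul, eval_C, integral_const_mul]

/-- Repeated integration by parts against a polynomial vanishing to order `k` at `±1`. -/
lemma integral_iterate_derivative_mul (w : ℝ[X]) (k : ℕ) (hw : (X ^ 2 - 1) ^ k ∣ w) (q : ℝ[X]) :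
    ∫ x in (-1 : ℝ)..1, (derivative^[k] w * q).eval x =
      (-1) ^ k * ∫ x in (-1 : ℝ)..1, (w * derivative^[k] q).eval x := by
  suffices h : ∀ i ≤ k, ∀ q : ℝ[X], ∫ x in (-1 : ℝ)..1, (derivative^[i] w * q).eval x =
      (-1) ^ i * ∫ x in (-1 : ℝ)..1, (w * derivative^[i] q).eval x from h k le_rfl q
  intro i
  induction i with
  | zero => intro _ q; simp
  | succ i ih =>
    intro hi q
    have hdvd : (X ^ 2 - 1 : ℝ[X]) ∣ derivative^[i] w :=
      (dvd_pow_self _ (by omega)).trans (pow_sub_dvd_iterate_derivative_of_pow_dvd i hw)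
    obtain ⟨r, hr⟩ := hdvd
    have hparts : ∫ x in (-1 : ℝ)..1, (derivative (derivative^[i] w * q)).eval x = 0 := by
      rw [integral_derivative_eval, hr]
      simp
    rw [derivative_mul, integral_eval_add, ih (by omega) (derivative q)] at hparts
    rw [Function.iterate_succ_apply', Function.iterate_succ_apply, pow_succ]
    linarith

lemma natDegree_one_sub_X_sq_pow (m : ℕ) : ((1 - X ^ 2 : ℝ[X]) ^ m).natDegree ≤ 2 * m := by
  have h : (1 - X ^ 2 : ℝ[X]).natDegree ≤ 2 := by compute_degree
  exact (natDegree_pow_le_of_le m h).trans_eq (mul_comm _ _)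

lemma coeff_one_sub_X_sq_pow (m : ℕ) : ((1 - X ^ 2 : ℝ[X]) ^ m).coeff (2 * m) = (-1) ^ m := by
  have h : (1 - X ^ 2 : ℝ[X]).natDegree ≤ 2 := by compute_degree
  rw [mul_comm, coeff_pow_of_natDegree_le h]
  simp [coeff_one]

lemma integral_one_sub_sq_pow (j : ℕ) :
    ∫ x in (-1 : ℝ)..1, ((1 - X ^ 2 : ℝ[X]) ^ j).eval x =
      2 * 4 ^ j * (j.factorial : ℝ) ^ 2 / (2 * j + 1).factorial := by
  induction j with
  | zero => norm_num
  | succ j ih =>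
    have h : derivative (X * (1 - X ^ 2 : ℝ[X]) ^ (j + 1)) =
        C (2 * (j : ℝ) + 3) * (1 - X ^ 2) ^ (j + 1) + C (-(2 * (j : ℝ) + 2)) * (1 - X ^ 2) ^ j := by
      simp only [derivative_mul, derivative_X, derivative_pow, derivative_sub, derivative_one,
        map_add, map_mul, map_neg, map_ofNat, map_natCast]
      push_cast
      ring
    have h2 := integral_derivative_eval (X * (1 - X ^ 2 : ℝ[X]) ^ (j + 1)) (-1) 1
    rw [h, integral_eval_add, integral_eval_C_mul, integral_eval_C_mul, ih] at h2
    generalize (∫ x in (-1 : ℝ)..1, ((1 - X ^ 2 : ℝ[X]) ^ (j + 1)).eval x) = I at h2 ⊢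
    simp only [eval_mul, eval_pow, eval_sub, eval_one, eval_X] at h2
    have h3 : (0 : ℝ) < 2 * j + 3 := by positivity
    have e : ((2 * (j + 1) + 1).factorial : ℝ) =
        (2 * j + 3) * ((2 * j + 2) * (2 * j + 1).factorial) := by
      rw [show 2 * (j + 1) + 1 = (2 * j + 1) + 1 + 1 by ring, Nat.factorial_succ,
        Nat.factorial_succ]
      push_cast; ring
    rw [e, Nat.factorial_succ]
    push_cast
    norm_num at h2
    have h4 : (0 : ℝ) < (2 * j + 1).factorial := by positivity
    field_simp at h2 ⊢
    linear_combination h2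

lemma natDegree_legP_le (j : ℕ) : (legP j).natDegree ≤ j := by
  have h : ((X ^ 2 - 1 : ℝ[X]) ^ j).natDegree ≤ j * 2 :=
    natDegree_pow_le_of_le j (by compute_degree)
  refine (natDegree_C_mul_le _ _).trans ((natDegree_iterate_derivative _ _).trans ?_)
  omega

lemma coeff_legP_self (j : ℕ) :
    (legP j).coeff j = (2 * j).factorial / (2 ^ j * (j.factorial : ℝ) ^ 2) := by
  have h1 : (X ^ 2 - 1 : ℝ[X]).natDegree ≤ 2 := by compute_degree
  have h2 : ((X ^ 2 - 1 : ℝ[X]) ^ j).coeff (j + j) = 1 := by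
    rw [show j + j = j * 2 by ring, coeff_pow_of_natDegree_le h1]
    simp [coeff_one]
  have h3 : (j.factorial : ℝ) * ((j + j).descFactorial j : ℝ) = (j + j).factorial := by
    have := Nat.factorial_mul_descFactorial (n := j + j) (k := j) (by omega)
    rw [Nat.add_sub_cancel] at this
    exact_mod_cast this
  rw [legP, coeff_C_mul, coeff_iterate_derivative, h2, two_mul, ← h3]
  have : (0 : ℝ) < j.factorial := by positivity
  simp only [nsmul_eq_mul, mul_one]
  field_simp

/-- By Rodrigues' formula, integrating against `legP j` only sees the `j`-th derivative. -/
lemma integral_legP_mul (j : ℕ) (q : ℝ[X]) :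
    ∫ x in (-1 : ℝ)..1, (legP j * q).eval x = 1 / (2 ^ j * (j.factorial : ℝ)) *
      ∫ x in (-1 : ℝ)..1, ((1 - X ^ 2) ^ j * derivative^[j] q).eval x := by
  rw [legP, mul_assoc, integral_eval_C_mul, integral_iterate_derivative_mul _ _ dvd_rfl]
  congr 1
  rw [show (1 - X ^ 2 : ℝ[X]) = C (-1) * (X ^ 2 - 1) by simp, mul_pow, ← map_pow, mul_assoc,
    integral_eval_C_mul]

/-- Degree of the polynomial `(1 - x²)^m D^m P_j` entering the associated Legendre functions. -/
lemma natDegree_weighted_legP_le {j m : ℕ} (hm : m ≤ j) :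
    ((1 - X ^ 2) ^ m * derivative^[m] (legP j)).natDegree ≤ j + m := by
  refine natDegree_mul_le.trans ?_
  have h1 := natDegree_one_sub_X_sq_pow m
  have h2 := natDegree_iterate_derivative (legP j) m
  have h3 := natDegree_legP_le j
  omega

lemma coeff_weighted_legP {j m : ℕ} (hm : m ≤ j) :
    ((1 - X ^ 2) ^ m * derivative^[m] (legP j)).coeff (j + m) =
      (-1) ^ m * (j.factorial / (j - m).factorial * (legP j).coeff j) := by
  have h3 := natDegree_legP_le j
  rw [show j + m = 2 * m + (j - m) by omega,
    coeff_mul_add_eq_of_natDegree_le (natDegree_one_sub_X_sq_pow m)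
      ((natDegree_iterate_derivative (legP j) m).trans (by omega)),
    coeff_one_sub_X_sq_pow, coeff_iterate_derivative, Nat.sub_add_cancel hm,
    ← Nat.factorial_mul_descFactorial hm]
  have : (0 : ℝ) < (j - m).factorial := by positivity
  push_cast
  rw [nsmul_eq_mul]
  field_simp

lemma integral_assocLeg_eq {m j j' : ℕ} :
    ∫ x in (-1 : ℝ)..1,
      ((1 - X ^ 2 : ℝ[X]) ^ m * derivative^[m] (legP j) * derivative^[m] (legP j')).eval x =
      (-1) ^ m * (1 / (2 ^ j' * (j'.factorial : ℝ)) * ∫ x in (-1 : ℝ)..1, ((1 - X ^ 2 : ℝ[X]) ^ j' *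
        derivative^[j' + m] ((1 - X ^ 2) ^ m * derivative^[m] (legP j))).eval x) := by
  have hdvd : (X ^ 2 - 1 : ℝ[X]) ^ m ∣ (1 - X ^ 2) ^ m * derivative^[m] (legP j) :=
    (pow_dvd_pow_of_dvd ⟨-1, by ring⟩ m).mul_right _
  have h := integral_iterate_derivative_mul _ m hdvd (legP j')
  rw [mul_comm (derivative^[m] _) (legP j'), integral_legP_mul,
    ← Function.iterate_add_apply] at h
  rw [h, ← mul_assoc, ← mul_pow]
  simp

lemma integral_assocLeg_of_lt {m j j' : ℕ} (hm : m ≤ j) (hj : j < j') :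
    ∫ x in (-1 : ℝ)..1,
      ((1 - X ^ 2 : ℝ[X]) ^ m * derivative^[m] (legP j) * derivative^[m] (legP j')).eval x = 0 := by
  rw [integral_assocLeg_eq, iterate_derivative_eq_zero
    ((natDegree_weighted_legP_le hm).trans_lt (by omega))]
  simp

lemma integral_assocLeg_of_ne {m j j' : ℕ} (hm : m ≤ j) (hm' : m ≤ j') (hj : j ≠ j') :
    ∫ x in (-1 : ℝ)..1,
      ((1 - X ^ 2 : ℝ[X]) ^ m * derivative^[m] (legP j) * derivative^[m] (legP j')).eval x = 0 := by
  rcases hj.lt_or_gt with h | h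
  · exact integral_assocLeg_of_lt hm h
  · rw [mul_right_comm]
    exact integral_assocLeg_of_lt hm' h

lemma integral_assocLeg_self {m j : ℕ} (hm : m ≤ j) :
    ∫ x in (-1 : ℝ)..1,
      ((1 - X ^ 2 : ℝ[X]) ^ m * derivative^[m] (legP j) * derivative^[m] (legP j)).eval x =
      2 / (2 * j + 1) * ((j + m).factorial / (j - m).factorial) := by
  have hD : derivative^[j + m] ((1 - X ^ 2) ^ m * derivative^[m] (legP j)) =
      C ((j + m).factorial *
        ((-1) ^ m * (j.factorial / (j - m).factorial * (legP j).coeff j))) := by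
    have hdeg : (derivative^[j + m] ((1 - X ^ 2) ^ m * derivative^[m] (legP j))).natDegree = 0 := by
      have h1 := natDegree_iterate_derivative ((1 - X ^ 2) ^ m * derivative^[m] (legP j)) (j + m)
      have h2 := natDegree_weighted_legP_le hm
      omega
    rw [eq_C_of_natDegree_eq_zero hdeg, coeff_iterate_derivative, zero_add,
      Nat.descFactorial_self, coeff_weighted_legP hm, nsmul_eq_mul]
  rw [integral_assocLeg_eq, hD, mul_comm _ (C _), integral_eval_C_mul, integral_one_sub_sq_pow,
    coeff_legP_self, Nat.factorial_succ (2 * j), show (4 : ℝ) = 2 * 2 by norm_num, mul_pow]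
  have hs : ((-1 : ℝ) ^ m) * (-1) ^ m = 1 := by rw [← mul_pow]; simp
  have h1 : (0 : ℝ) < (j - m).factorial := by positivity
  have h2 : (0 : ℝ) < j.factorial := by positivity
  have h3 : (0 : ℝ) < (2 * j).factorial := by positivity
  push_cast
  field_simp
  linear_combination hs

end Legendre

section Coordinates

open MeasureTheory Set

/-- Cylindrical coordinates `(t, φ) ↦ (√(1-t²) cos φ, √(1-t²) sin φ, t)` on the sphere, with the
height `t` clamped to `[-1, 1]`. -/
def cylPoint (z : ℝ × ℝ) : S2 :=
  ⟨!₂[√(1 - (max (-1) (min 1 z.1)) ^ 2) * Real.cos z.2,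
      √(1 - (max (-1) (min 1 z.1)) ^ 2) * Real.sin z.2, max (-1) (min 1 z.1)], by
    have h1 : -1 ≤ max (-1) (min 1 z.1) := le_max_left _ _
    have h2 : max (-1) (min 1 z.1) ≤ 1 := max_le (by norm_num) (min_le_left _ _)
    generalize max (-1) (min 1 z.1) = u at h1 h2
    have hs := Real.sq_sqrt (show 0 ≤ 1 - u ^ 2 by nlinarith)
    rw [mem_sphere_zero_iff_norm, EuclideanSpace.norm_eq, Real.sqrt_eq_one, Fin.sum_univ_three]
    simp only [Real.norm_eq_abs, sq_abs]
    simp only [Matrix.cons_val_zero, Matrix.cons_val_one, Matrix.cons_val]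
    linear_combination (Real.cos z.2 ^ 2 + Real.sin z.2 ^ 2) * hs +
      (1 - u ^ 2) * Real.sin_sq_add_cos_sq z.2⟩

lemma continuous_cylPoint : Continuous cylPoint := by
  refine Continuous.subtype_mk ?_ _
  refine (PiLp.continuous_toLp 2 _).comp (continuous_pi fun i => ?_)
  fin_cases i <;> simp <;> fun_prop

/-- Lebesgue measure on the domain of the cylindrical coordinates. -/
def cylMeasure : Measure (ℝ × ℝ) :=
  (volume.restrict (Ioc (-1 : ℝ) 1)).prod (volume.restrict (Ioc (-Real.pi) Real.pi))

instance : IsFiniteMeasure cylMeasure := by unfold cylMeasure; infer_instance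

lemma cylMeasure_eq : cylMeasure = volume.restrict (Ioc (-1 : ℝ) 1 ×ˢ Ioc (-Real.pi) Real.pi) := by
  rw [cylMeasure, Measure.prod_restrict, Measure.volume_eq_prod]

/-- The height-dependent factor of `sphY j k`. -/
def sphHeight (j : ℕ) (k : ℤ) (t : ℝ) : ℝ :=
  1 / Real.sqrt (2 * Real.pi) *
    Real.sqrt ((2 * (j : ℝ) + 1) / 2 *
      ((((j : ℤ) - k).toNat.factorial : ℝ) / (((j : ℤ) + k).toNat.factorial : ℝ))) *
    assocLeg j k t

lemma continuous_sphHeight (j : ℕ) (k : ℤ) : Continuous (sphHeight j k) := by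
  unfold sphHeight assocLeg assocLegNat
  split_ifs <;> fun_prop

/-- `sphY j k` in cylindrical coordinates. -/
def cylY (j : ℕ) (k : ℤ) (z : ℝ × ℝ) : ℂ :=
  (sphHeight j k z.1 : ℂ) * Complex.exp (Complex.I * (k : ℂ) * (z.2 : ℂ))

lemma continuous_cylY (j : ℕ) (k : ℤ) : Continuous (cylY j k) := by
  have := continuous_sphHeight j k
  unfold cylY
  fun_prop

lemma sphY_cylPoint (j : ℕ) (k : ℤ) {t φ : ℝ} (ht : t ∈ Ioo (-1 : ℝ) 1)
    (hφ : φ ∈ Ioc (-Real.pi) Real.pi) : sphY j k (cylPoint (t, φ)) = cylY j k (t, φ) := by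
  have hclamp : max (-1) (min 1 t) = t := by
    rw [min_eq_right ht.2.le, max_eq_right ht.1.le]
  have hs : 0 < √(1 - t ^ 2) := Real.sqrt_pos.2 (by nlinarith [ht.1, ht.2])
  have harg := Complex.arg_mul_cos_add_sin_mul_I hs hφ
  have e : (((√(1 - t ^ 2) * Real.cos φ : ℝ) : ℂ) + ((√(1 - t ^ 2) * Real.sin φ : ℝ) : ℂ) *
      Complex.I) = (√(1 - t ^ 2) : ℂ) * (Complex.cos φ + Complex.sin φ * Complex.I) := by
    push_cast; ring
  simp only [sphY, cylY, cylPoint, sphHeight, PiLp.toLp_apply, Matrix.cons_val_zero,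
    Matrix.cons_val_one, Matrix.cons_val, hclamp]
  rw [e, harg]

lemma ae_sphY_cylPoint : ∀ᵐ z ∂cylMeasure, ∀ j k, sphY j k (cylPoint z) = cylY j k z := by
  have h1 : ∀ᵐ z ∂cylMeasure, z ∈ Ioc (-1 : ℝ) 1 ×ˢ Ioc (-Real.pi) Real.pi := by
    rw [cylMeasure_eq]
    exact ae_restrict_mem (measurableSet_Ioc.prod measurableSet_Ioc)
  have h2 : ∀ᵐ z ∂cylMeasure, z.1 ≠ 1 := by
    refine Measure.quasiMeasurePreserving_fst.ae (p := fun t : ℝ => t ≠ 1) ?_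
    exact ae_restrict_of_ae (Measure.ae_ne volume 1)
  filter_upwards [h1, h2] with z hz hz' j k
  exact sphY_cylPoint j k ⟨hz.1.1, lt_of_le_of_ne hz.1.2 hz'⟩ hz.2

lemma memLp_of_continuous_cylMeasure {f : ℝ × ℝ → ℂ} (hf : Continuous f) :
    MemLp f 2 cylMeasure := by
  obtain ⟨C, hC⟩ := (isCompact_Icc (a := (-1 : ℝ)) (b := 1)).prod
    (isCompact_Icc (a := -Real.pi) (b := Real.pi)) |>.exists_bound_of_continuousOn hf.continuousOn
  refine MemLp.of_bound hf.aestronglyMeasurable C ?_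
  rw [cylMeasure_eq]
  filter_upwards [ae_restrict_mem (measurableSet_Ioc.prod measurableSet_Ioc)] with z hz
  exact hC z ⟨Ioc_subset_Icc_self hz.1, Ioc_subset_Icc_self hz.2⟩

/-- Up to a sign depending only on `k`, `sphHeight j k` only depends on `|k|`. -/
lemma exists_sphHeight_eq (k : ℤ) : ∃ σ : ℝ, σ * σ = 1 ∧ ∀ j : ℕ, k.natAbs ≤ j → ∀ t : ℝ,
    sphHeight j k t = σ * (1 / √(2 * Real.pi) * √((2 * (j : ℝ) + 1) / 2 *
      ((j - k.natAbs).factorial / (j + k.natAbs).factorial)) *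
      (√(1 - t ^ 2) ^ k.natAbs * (derivative^[k.natAbs] (legP j)).eval t)) := by
  obtain ⟨m, rfl | rfl⟩ := k.eq_nat_or_neg
  · refine ⟨(-1) ^ m, by rw [← mul_pow]; simp, fun j hj t => ?_⟩
    rw [Int.natAbs_natCast] at hj ⊢
    rw [sphHeight, assocLeg, if_pos (Int.natCast_nonneg m), Int.toNat_natCast, assocLegNat,
      show ((j : ℤ) - m).toNat = j - m by omega, show ((j : ℤ) + m).toNat = j + m by omega]
    ring
  · rcases Nat.eq_zero_or_pos m with rfl | hm
    · refine ⟨1, by simp, fun j hj t => ?_⟩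
      simp [sphHeight, assocLeg, assocLegNat]
    · refine ⟨1, by simp, fun j hj t => ?_⟩
      rw [Int.natAbs_neg, Int.natAbs_natCast] at hj ⊢
      have hs : ((-1 : ℝ) ^ m) * (-1) ^ m = 1 := by rw [← mul_pow]; simp
      have h1 : (0 : ℝ) < (j - m).factorial := by positivity
      have h2 : (0 : ℝ) < (j + m).factorial := by positivity
      have hsqrt : √((2 * (j : ℝ) + 1) / 2 * ((j + m).factorial / (j - m).factorial)) *
          ((j - m).factorial / (j + m).factorial) =
          √((2 * (j : ℝ) + 1) / 2 * ((j - m).factorial / (j + m).factorial)) := by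
        conv_lhs => rw [← Real.sqrt_sq (show (0 : ℝ) ≤ (j - m).factorial / (j + m).factorial by
          positivity), ← Real.sqrt_mul (by positivity)]
        congr 1
        field_simp
      rw [sphHeight, assocLeg, if_neg (by omega), neg_neg, Int.toNat_natCast, assocLegNat,
        show ((j : ℤ) - -m).toNat = j + m by omega, show ((j : ℤ) + -m).toNat = j - m by omega,
        ← hsqrt]
      linear_combination (1 / √(2 * Real.pi) *
        √((2 * (j : ℝ) + 1) / 2 * ((j + m).factorial / (j - m).factorial)) *
          ((j - m).factorial / (j + m).factorial) * √(1 - t ^ 2) ^ m *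
          (derivative^[m] (legP j)).eval t) * hs

lemma setIntegral_sphHeight_mul {j j' : ℕ} {k : ℤ} (hj : k.natAbs ≤ j) (hj' : k.natAbs ≤ j') :
    ∫ t in Ioc (-1 : ℝ) 1, sphHeight j k t * sphHeight j' k t =
      if j = j' then 1 / (2 * Real.pi) else 0 := by
  obtain ⟨σ, hσ, h⟩ := exists_sphHeight_eq k
  set c : ℕ → ℝ := fun j => 1 / √(2 * Real.pi) * √((2 * (j : ℝ) + 1) / 2 *
      ((j - k.natAbs).factorial / (j + k.natAbs).factorial)) with hc
  have key : ∀ t ∈ Ioc (-1 : ℝ) 1, sphHeight j k t * sphHeight j' k t = (c j * c j') *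
      ((1 - X ^ 2 : ℝ[X]) ^ k.natAbs * derivative^[k.natAbs] (legP j) *
        derivative^[k.natAbs] (legP j')).eval t := by
    intro t ht
    have hs : √(1 - t ^ 2) ^ k.natAbs * √(1 - t ^ 2) ^ k.natAbs = (1 - t ^ 2) ^ k.natAbs := by
      rw [← mul_pow, Real.mul_self_sqrt (by nlinarith [ht.1, ht.2])]
    rw [h j hj, h j' hj']
    simp only [eval_mul, eval_pow, eval_sub, eval_one, eval_X, ← hs, hc]
    linear_combination (c j * c j' * (√(1 - t ^ 2) ^ k.natAbs * √(1 - t ^ 2) ^ k.natAbs *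
      (derivative^[k.natAbs] (legP j)).eval t * (derivative^[k.natAbs] (legP j')).eval t)) * hσ
  rw [setIntegral_congr_fun measurableSet_Ioc key, integral_const_mul,
    ← intervalIntegral.integral_of_le (by norm_num)]
  split_ifs with hjj
  · subst hjj
    have h1 : (0 : ℝ) < (j - k.natAbs).factorial := by positivity
    have h2 : (0 : ℝ) < (j + k.natAbs).factorial := by positivity
    have hcc : c j * c j = 1 / (2 * Real.pi) * ((2 * (j : ℝ) + 1) / 2 *
        ((j - k.natAbs).factorial / (j + k.natAbs).factorial)) := by
      simp only [hc]
      rw [mul_mul_mul_comm, Real.mul_self_sqrt (by positivity), div_mul_div_comm,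
        Real.mul_self_sqrt (by positivity), one_mul]
    rw [integral_assocLeg_self hj, hcc]
    field_simp
  · rw [integral_assocLeg_of_ne hj hj' hjj, mul_zero]

lemma setIntegral_exp_mul_conj (k k' : ℤ) :
    ∫ φ in Ioc (-Real.pi) Real.pi, (starRingEnd ℂ) (Complex.exp (Complex.I * k * (φ : ℂ))) *
      Complex.exp (Complex.I * k' * (φ : ℂ)) = if k = k' then 2 * (Real.pi : ℂ) else 0 := by
  have e : ∀ φ : ℝ, (starRingEnd ℂ) (Complex.exp (Complex.I * k * (φ : ℂ))) *
      Complex.exp (Complex.I * k' * (φ : ℂ)) =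
      Complex.exp (Complex.I * ((k' - k : ℤ) : ℂ) * (φ : ℂ)) := by
    intro φ
    rw [← Complex.exp_conj, ← Complex.exp_add]
    congr 1
    simp only [map_mul, Complex.conj_I, Complex.conj_ofReal, map_intCast]
    push_cast; ring
  simp only [e]
  rw [← intervalIntegral.integral_of_le (by linarith [Real.pi_pos])]
  split_ifs with h
  · subst h
    simp
    ring
  · have hne : Complex.I * ((k' - k : ℤ) : ℂ) ≠ 0 :=
      mul_ne_zero Complex.I_ne_zero (Int.cast_ne_zero.2 (sub_ne_zero.2 (Ne.symm h)))
    rw [integral_exp_mul_complex hne, div_eq_zero_iff]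
    left
    rw [sub_eq_zero, Complex.exp_eq_exp_iff_exists_int]
    exact ⟨k' - k, by push_cast; ring⟩

lemma integral_conj_cylY_mul {j j' : ℕ} {k k' : ℤ} (hj : k.natAbs ≤ j) (hj' : k'.natAbs ≤ j') :
    ∫ z, (starRingEnd ℂ) (cylY j k z) * cylY j' k' z ∂cylMeasure =
      if j = j' ∧ k = k' then 1 else 0 := by
  have e : ∀ z : ℝ × ℝ, (starRingEnd ℂ) (cylY j k z) * cylY j' k' z =
      ((sphHeight j k z.1 * sphHeight j' k' z.1 : ℝ) : ℂ) *
      ((starRingEnd ℂ) (Complex.exp (Complex.I * k * (z.2 : ℂ))) *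
      Complex.exp (Complex.I * k' * (z.2 : ℂ))) := by
    intro z
    simp only [cylY, map_mul, Complex.conj_ofReal]
    push_cast; ring
  simp only [e]
  rw [cylMeasure, integral_prod_mul
    (fun t : ℝ => ((sphHeight j k t * sphHeight j' k' t : ℝ) : ℂ))
    (fun φ : ℝ => (starRingEnd ℂ) (Complex.exp (Complex.I * k * (φ : ℂ))) *
      Complex.exp (Complex.I * k' * (φ : ℂ))), setIntegral_exp_mul_conj]
  by_cases hk : k = k'
  · subst hk
    rw [integral_complex_ofReal, setIntegral_sphHeight_mul hj hj', if_pos rfl]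
    have := Real.pi_ne_zero
    by_cases hjj : j = j'
    · simp only [hjj, and_self, if_true]
      push_cast
      field_simp
    · simp [hjj]
  · simp [hk]

/-- `sphF n` in cylindrical coordinates. -/
def cylF (n : ℕ) : ℝ × ℝ → ℂ := cylY n.sqrt ((n : ℤ) - n.sqrt ^ 2 - n.sqrt)

lemma continuous_cylF (n : ℕ) : Continuous (cylF n) := continuous_cylY _ _

lemma ae_sphF_cylPoint : ∀ᵐ z ∂cylMeasure, ∀ n, sphF n (cylPoint z) = cylF n z := by
  filter_upwards [ae_sphY_cylPoint] with z hz n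
  exact hz _ _

lemma integral_conj_cylF_mul (n n' : ℕ) :
    ∫ z, (starRingEnd ℂ) (cylF n z) * cylF n' z ∂cylMeasure = if n = n' then 1 else 0 := by
  have hk : ∀ n : ℕ, ((n : ℤ) - n.sqrt ^ 2 - n.sqrt).natAbs ≤ n.sqrt := by
    intro n
    have h1 := Nat.sqrt_le_add n
    have h2 := Nat.sqrt_le' n
    zify at h1 h2
    have h3 : |(n : ℤ) - n.sqrt ^ 2 - n.sqrt| ≤ n.sqrt := abs_le.2 ⟨by linarith, by nlinarith⟩
    zify
    exact h3
  refine (integral_conj_cylY_mul (hk n) (hk n')).trans (if_congr ⟨fun h => ?_, ?_⟩ rfl rfl)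
  · have h2 := h.2
    rw [h.1] at h2
    omega
  · rintro rfl
    exact ⟨rfl, rfl⟩

end Coordinates

section L2

open MeasureTheory Filter Topology

/-- If a square-summable orthonormal expansion converges pointwise almost everywhere, then its
coefficients are the Fourier coefficients of its pointwise sum. -/
lemma integral_conj_mul_of_hasSum {Y ι : Type*} [MeasurableSpace Y] {ν : Measure Y} [Countable ι]
    {e : ι → Y → ℂ} {a : ι → ℂ} {f : Y → ℂ} (he : ∀ i, MemLp (e i) 2 ν)
    (horth : ∀ i j, ∫ y, (starRingEnd ℂ) (e i y) * e j y ∂ν = Set.indicator {i} 1 j)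
    (ha : Summable fun i => ‖a i‖ ^ 2) (hf : ∀ᵐ y ∂ν, HasSum (fun i => a i * e i y) (f y)) (i : ι) :
    Integrable (fun y => (starRingEnd ℂ) (e i y) * f y) ν ∧
      ∫ y, (starRingEnd ℂ) (e i y) * f y ∂ν = a i := by
  classical
  set E : ι → Lp ℂ 2 ν := fun i => (he i).toLp with hE
  have hEe : ∀ i, E i =ᵐ[ν] e i := fun i => (he i).coeFn_toLp
  have hinner : ∀ i j, inner ℂ (E i) (E j) = Set.indicator {i} 1 j := by
    intro i j
    rw [L2.inner_def, ← horth i j]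
    refine integral_congr_ae ?_
    filter_upwards [hEe i, hEe j] with y h1 h2
    rw [h1, h2, RCLike.inner_apply, mul_comm]
  have hON : Orthonormal ℂ E := by
    rw [orthonormal_iff_ite]
    intro i j
    rw [hinner]
    simp [Set.indicator_apply, eq_comm]
  have hsum : Summable fun i => a i • E i :=
    (hON.orthogonalFamily.summable_iff_norm_sq_summable a).2 ha
  obtain ⟨Φ, hΦ⟩ := hsum
  have hcoef : inner ℂ (E i) Φ = a i := by
    have h1 := hΦ.mapL (innerSL ℂ (E i))
    have h2 : HasSum (fun j => innerSL ℂ (E i) (a j • E j)) (a i) := by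
      convert hasSum_single (f := fun j => innerSL ℂ (E i) (a j • E j)) i ?_ using 1
      · simp [innerSL_apply_apply, hON.1 i]
      · intro j hj
        simp [innerSL_apply_apply, hinner, hj]
    exact h1.unique h2
  obtain ⟨S, hS⟩ := exists_seq_tendsto (atTop : Filter (Finset ι))
  obtain ⟨ns, hns, hae⟩ :=
    (tendstoInMeasure_of_tendsto_Lp (hΦ.comp hS)).exists_seq_tendsto_ae
  have hcoe : ∀ᵐ y ∂ν, ∀ s : Finset ι, (∑ i ∈ s, a i • E i : Lp ℂ 2 ν) y = ∑ i ∈ s, a i * e i y := by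
    refine ae_all_iff.2 fun s => ?_
    have h1 : ∀ᵐ y ∂ν, ∀ i, (a i • E i : Lp ℂ 2 ν) y = a i * e i y := by
      refine ae_all_iff.2 fun i => ?_
      filter_upwards [Lp.coeFn_smul (a i) (E i), hEe i] with y h1 h2
      rw [h1, Pi.smul_apply, h2, smul_eq_mul]
    filter_upwards [Lp.coeFn_finsetSum s (fun i => a i • E i), h1] with y h2 h3
    rw [h2, Finset.sum_apply]
    exact Finset.sum_congr rfl fun i _ => h3 i
  have hfΦ : Φ =ᵐ[ν] f := by
    filter_upwards [hae, hcoe, hf] with y h1 h2 h3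
    refine tendsto_nhds_unique h1 ?_
    have h4 := (h3.comp hS).comp hns.tendsto_atTop
    refine h4.congr fun n => ?_
    simp only [Function.comp_apply]
    exact (h2 _).symm
  have hcongr : (fun y => inner ℂ (E i y) (Φ y)) =ᵐ[ν] fun y => (starRingEnd ℂ) (e i y) * f y := by
    filter_upwards [hEe i, hfΦ] with y h1 h2
    rw [h1, h2, RCLike.inner_apply, mul_comm]
  refine ⟨(L2.integrable_inner (E i) Φ).congr hcongr, ?_⟩
  rw [← hcoef, L2.inner_def]
  exact (integral_congr_ae hcongr).symm

end L2

section PosDef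

open MeasureTheory Filter Topology

/-- Positive definiteness allows repeated points. -/
lemma IsPosDefKer.sum_nonneg {K : S2 → S2 → ℂ} (hK : IsPosDefKer K) {ι : Type*} (s : Finset ι)
    (p : ι → S2) (c : ι → ℂ) :
    0 ≤ ∑ i ∈ s, ∑ j ∈ s, c i * (starRingEnd ℂ) (c j) * K (p i) (p j) := by
  classical
  rcases s.eq_empty_or_nonempty with rfl | hs
  · simp
  have h := hK (s.image p) (hs.image p) fun ξ => ∑ i ∈ s with p i = ξ, c i
  refine h.trans_eq ?_
  have hmaps : ∀ i ∈ s, p i ∈ s.image p := fun i hi => Finset.mem_image_of_mem p hi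
  rw [← Finset.sum_fiberwise_of_maps_to hmaps]
  refine Finset.sum_congr rfl fun ξ _ => ?_
  rw [Finset.sum_congr rfl fun i _ => (Finset.sum_fiberwise_of_maps_to hmaps _).symm,
    Finset.sum_comm]
  refine Finset.sum_congr rfl fun ζ _ => ?_
  rw [map_sum, Finset.sum_mul_sum, Finset.sum_mul]
  refine Finset.sum_congr rfl fun i hi => ?_
  rw [Finset.sum_mul]
  refine Finset.sum_congr rfl fun j hj => ?_
  rw [(Finset.mem_filter.1 hi).2, (Finset.mem_filter.1 hj).2]

lemma IsPosDefKer.integral_simpleFunc_nonneg {K : S2 → S2 → ℂ} (hK : IsPosDefKer K)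
    {Y : Type*} [MeasurableSpace Y] (μ : Measure Y) [IsFiniteMeasure μ]
    (s : SimpleFunc Y (S2 × ℂ)) :
    0 ≤ ∫ z, (s z.1).2 * (starRingEnd ℂ) (s z.2).2 * K (s z.1).1 (s z.2).1 ∂(μ.prod μ) := by
  classical
  set I : S2 × ℂ → Y → ℂ := fun v => (s ⁻¹' {v}).indicator 1 with hI
  have hint : ∀ v, Integrable (I v) μ := fun v =>
    (integrable_const (1 : ℂ)).indicator (s.measurableSet_fiber v)
  have hIv : ∀ v, ∫ y, I v y ∂μ = (μ.real (s ⁻¹' {v}) : ℂ) := by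
    intro v
    simp [hI, integral_indicator (s.measurableSet_fiber v)]
  have hexpand : ∀ z : Y × Y,
      (s z.1).2 * (starRingEnd ℂ) (s z.2).2 * K (s z.1).1 (s z.2).1 =
      ∑ v ∈ s.range, ∑ w ∈ s.range,
        I v z.1 * I w z.2 * (v.2 * (starRingEnd ℂ) w.2 * K v.1 w.1) := by
    intro z
    rw [Finset.sum_eq_single_of_mem (s z.1) (s.mem_range_self _),
      Finset.sum_eq_single_of_mem (s z.2) (s.mem_range_self _)]
    · simp [hI]
    · intro w _ hw
      simp [hI, hw.symm]
    · intro v _ hv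
      simp [hI, hv.symm]
  simp only [hexpand]
  rw [integral_finsetSum _ fun v _ => integrable_finsetSum _ fun w _ =>
    ((hint v).mul_prod (hint w)).mul_const _]
  refine (hK.sum_nonneg s.range (fun v => v.1)
    fun v => (μ.real (s ⁻¹' {v}) : ℂ) * v.2).trans_eq ?_
  refine Finset.sum_congr rfl fun v _ => ?_
  rw [integral_finsetSum _ fun w _ => ((hint v).mul_prod (hint w)).mul_const _]
  refine Finset.sum_congr rfl fun w _ => ?_
  rw [integral_mul_const, integral_prod_mul, hIv, hIv, map_mul, Complex.conj_ofReal]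
  ring

lemma IsPosDefKer.integral_nonneg {K : S2 → S2 → ℂ} (hK : IsPosDefKer K)
    (hcont : Continuous fun p : S2 × S2 => K p.1 p.2)
    {Y : Type*} [MeasurableSpace Y] (μ : Measure Y) [IsFiniteMeasure μ] [Nonempty Y]
    {p : Y → S2} (hp : Measurable p) {g : Y → ℂ} (hg : Measurable g) (hgi : Integrable g μ) :
    0 ≤ ∫ z, g z.1 * (starRingEnd ℂ) (g z.2) * K (p z.1) (p z.2) ∂(μ.prod μ) := by
  obtain ⟨C, hC⟩ := isCompact_univ.exists_bound_of_continuousOn hcont.continuousOn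
  replace hC : ∀ ξ ζ, ‖K ξ ζ‖ ≤ C := fun ξ ζ => hC (ξ, ζ) (Set.mem_univ _)
  set P : ℕ → SimpleFunc Y S2 :=
    SimpleFunc.approxOn p hp Set.univ (p (Classical.arbitrary Y)) (Set.mem_univ _)
  set G : ℕ → SimpleFunc Y ℂ := SimpleFunc.approxOn g hg Set.univ 0 (Set.mem_univ _)
  have hP : ∀ y, Tendsto (fun n => P n y) atTop (𝓝 (p y)) := fun y =>
    SimpleFunc.tendsto_approxOn hp _ (by simp)
  have hG : ∀ y, Tendsto (fun n => G n y) atTop (𝓝 (g y)) := fun y =>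
    SimpleFunc.tendsto_approxOn hg _ (by simp)
  have hGb : ∀ n y, ‖G n y‖ ≤ 2 * ‖g y‖ := fun n y =>
    (SimpleFunc.norm_approxOn_zero_le hg _ y n).trans_eq (two_mul _).symm
  refine ge_of_tendsto' (f := fun n : ℕ => ∫ z : Y × Y, G n z.1 * (starRingEnd ℂ) (G n z.2) *
      K (P n z.1) (P n z.2) ∂(μ.prod μ)) (x := atTop) ?_
    fun n => hK.integral_simpleFunc_nonneg μ ((P n).pair (G n))
  refine tendsto_integral_of_dominated_convergence
    (fun z => (2 * ‖g z.1‖) * (2 * ‖g z.2‖) * C) (fun n => ?_) ?_ (fun n => ?_) ?_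
  · refine Measurable.aestronglyMeasurable ?_
    have h1 := (P n).measurable
    have h2 := (G n).measurable
    have h3 : Measurable fun z : Y × Y => K (P n z.1) (P n z.2) :=
      hcont.measurable.comp ((h1.comp measurable_fst).prodMk (h1.comp measurable_snd))
    exact ((h2.comp measurable_fst).mul
      (Complex.continuous_conj.measurable.comp (h2.comp measurable_snd))).mul h3
  · exact ((hgi.norm.const_mul 2).mul_prod (hgi.norm.const_mul 2)).mul_const C
  · refine Eventually.of_forall fun z => ?_
    rw [norm_mul, norm_mul, RCLike.norm_conj]
    gcongr
    · exact hGb n _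
    · exact hGb n _
    · exact hC _ _
  · refine Eventually.of_forall fun z => ?_
    refine ((hG z.1).mul ((Complex.continuous_conj.tendsto _).comp (hG z.2))).mul ?_
    exact (hcont.tendsto (p z.1, p z.2)).comp ((hP z.1).prodMk_nhds (hP z.2))

end PosDef

section Main

open MeasureTheory Filter Topology

lemma tendsto_range_product_range :
    Tendsto (fun n : ℕ => Finset.range n ×ˢ Finset.range n) atTop atTop := by
  refine tendsto_atTop_finset_of_monotone (fun m n h => ?_) fun p => ⟨p.1 + p.2 + 1, ?_⟩
  · exact Finset.product_subset_product (Finset.range_mono h) (Finset.range_mono h)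
  · simp only [Finset.mem_product, Finset.mem_range]
    omega

/-- The finite sections of the coefficient matrix of a positive definite kernel are positive. -/
lemma IsPosDefKer.sum_coeff_nonneg {K : S2 → S2 → ℂ} (hK : IsPosDefKer K) {a : ℕ → ℕ → ℂ}
    (hcont : Continuous fun p : S2 × S2 => K p.1 p.2)
    (hexp : ∀ ξ ζ : S2, HasSum
      (fun p : ℕ × ℕ => a p.1 p.2 * sphF p.1 ξ * (starRingEnd ℂ) (sphF p.2 ζ)) (K ξ ζ))
    (hsq : Summable fun p : ℕ × ℕ => ‖a p.1 p.2‖ ^ 2) (y : ℕ → ℂ) (s : Finset ℕ) :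
    0 ≤ ∑ p ∈ s ×ˢ s, y p.1 * a p.1 p.2 * (starRingEnd ℂ) (y p.2) := by
  set e : ℕ × ℕ → (ℝ × ℝ) × (ℝ × ℝ) → ℂ :=
    fun p z => cylF p.1 z.1 * (starRingEnd ℂ) (cylF p.2 z.2) with he
  set k : (ℝ × ℝ) × (ℝ × ℝ) → ℂ := fun z => K (cylPoint z.1) (cylPoint z.2) with hk
  have hmem : ∀ p, MemLp (e p) 2 (cylMeasure.prod cylMeasure) := by
    intro p
    have h1 := (memLp_of_continuous_cylMeasure (continuous_cylF p.1)).integrable_norm_pow two_ne_zero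
    have h2 := (memLp_of_continuous_cylMeasure (continuous_cylF p.2)).integrable_norm_pow two_ne_zero
    have h3 := continuous_cylF p.1
    have h4 := continuous_cylF p.2
    have hc : Continuous (e p) :=
      (h3.comp continuous_fst).mul (Complex.continuous_conj.comp (h4.comp continuous_snd))
    rw [memLp_two_iff_integrable_sq_norm hc.aestronglyMeasurable]
    refine (h1.mul_prod h2).congr (Eventually.of_forall fun z => ?_)
    simp [he, mul_pow]
  have horth : ∀ p q, ∫ z, (starRingEnd ℂ) (e p z) * e q z ∂(cylMeasure.prod cylMeasure) =
      Set.indicator {p} 1 q := by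
    intro p q
    have h : ∀ z : (ℝ × ℝ) × (ℝ × ℝ), (starRingEnd ℂ) (e p z) * e q z =
        ((starRingEnd ℂ) (cylF p.1 z.1) * cylF q.1 z.1) *
          ((starRingEnd ℂ) (cylF q.2 z.2) * cylF p.2 z.2) := by
      intro z
      simp only [he, map_mul, Complex.conj_conj]
      ring
    simp only [h]
    rw [integral_prod_mul (fun z => (starRingEnd ℂ) (cylF p.1 z) * cylF q.1 z)
      (fun z => (starRingEnd ℂ) (cylF q.2 z) * cylF p.2 z), integral_conj_cylF_mul,
      integral_conj_cylF_mul]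
    simp only [Set.indicator_apply, Set.mem_singleton_iff, Prod.ext_iff, Pi.one_apply]
    by_cases h1 : p.1 = q.1 <;> by_cases h2 : q.2 = p.2 <;> simp [h1, h2, Ne.symm]
  have hsum : ∀ᵐ z ∂(cylMeasure.prod cylMeasure), HasSum (fun p => a p.1 p.2 * e p z) (k z) := by
    filter_upwards [Measure.quasiMeasurePreserving_fst.ae ae_sphF_cylPoint,
      Measure.quasiMeasurePreserving_snd.ae ae_sphF_cylPoint] with z h1 h2
    refine (hexp (cylPoint z.1) (cylPoint z.2)).congr_fun fun p => ?_
    rw [h1, h2, mul_assoc]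
  have hcoef := integral_conj_mul_of_hasSum hmem horth hsq hsum
  set g : ℝ × ℝ → ℂ := fun z => ∑ n ∈ s, y n * (starRingEnd ℂ) (cylF n z) with hg
  have hgc : Continuous g := continuous_finsetSum _ fun n _ =>
    continuous_const.mul (Complex.continuous_conj.comp (continuous_cylF n))
  have hpos := hK.integral_nonneg hcont cylMeasure continuous_cylPoint.measurable hgc.measurable
    ((memLp_of_continuous_cylMeasure hgc).integrable (by norm_num))
  refine hpos.trans_eq ?_
  have hexpand : ∀ z : (ℝ × ℝ) × (ℝ × ℝ),
      g z.1 * (starRingEnd ℂ) (g z.2) * K (cylPoint z.1) (cylPoint z.2) =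
      ∑ p ∈ s ×ˢ s, y p.1 * (starRingEnd ℂ) (y p.2) * ((starRingEnd ℂ) (e p z) * k z) := by
    intro z
    simp only [hg, map_sum]
    rw [Finset.sum_mul_sum, ← Finset.sum_product', Finset.sum_mul]
    refine Finset.sum_congr rfl fun p _ => ?_
    simp only [he, hk, map_mul, Complex.conj_conj]
    ring
  simp only [hexpand]
  rw [integral_finsetSum _ fun p _ => (hcoef p).1.const_mul _]
  refine Finset.sum_congr rfl fun p _ => ?_
  rw [integral_const_mul, (hcoef p).2]
  ring

/-- A kernel whose coefficient matrix has positive finite sections is positive definite. -/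
lemma isPosDefKer_of_sum_coeff_nonneg {K : S2 → S2 → ℂ} {a : ℕ → ℕ → ℂ}
    (hexp : ∀ ξ ζ : S2, HasSum
      (fun p : ℕ × ℕ => a p.1 p.2 * sphF p.1 ξ * (starRingEnd ℂ) (sphF p.2 ζ)) (K ξ ζ))
    (hpos : ∀ (y : ℕ → ℂ) (n : ℕ),
      0 ≤ ∑ p ∈ Finset.range n ×ˢ Finset.range n, y p.1 * a p.1 p.2 * (starRingEnd ℂ) (y p.2)) :
    IsPosDefKer K := by
  intro Ξ _ c
  have h : HasSum (fun p : ℕ × ℕ => (∑ ξ ∈ Ξ, c ξ * sphF p.1 ξ) * a p.1 p.2 *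
      (starRingEnd ℂ) (∑ ξ ∈ Ξ, c ξ * sphF p.2 ξ))
      (∑ ξ ∈ Ξ, ∑ ζ ∈ Ξ, c ξ * (starRingEnd ℂ) (c ζ) * K ξ ζ) := by
    refine (hasSum_sum fun ξ _ => hasSum_sum fun ζ _ =>
      (hexp ξ ζ).mul_left (c ξ * (starRingEnd ℂ) (c ζ))).congr_fun fun p => ?_
    rw [map_sum, Finset.sum_mul, Finset.sum_mul_sum]
    refine Finset.sum_congr rfl fun ξ _ => Finset.sum_congr rfl fun ζ _ => ?_
    rw [map_mul]
    ring
  exact ge_of_tendsto' (h.comp tendsto_range_product_range)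
    fun n => hpos (fun m => ∑ ξ ∈ Ξ, c ξ * sphF m ξ) n

end Main

/-- **Theorem 1.** A continuous Hermitian kernel `K` on `S²` with spherical-harmonic
expansion coefficients `a_{ℓ,ℓ'}` is positive definite if and only if the associated
operator `A` is a positive operator on `ℓ²`, i.e. `⟨A(y),y⟩ ≥ 0` for every `y ∈ ℓ²`. -/
theorem statement1 (K : S2 → S2 → ℂ) (a : ℕ → ℕ → ℂ)
    (hcont : Continuous fun p : S2 × S2 => K p.1 p.2)
    (hherm : ∀ ξ ζ : S2, K ξ ζ = (starRingEnd ℂ) (K ζ ξ))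
    (hexp : ∀ ξ ζ : S2, HasSum
      (fun p : ℕ × ℕ => a p.1 p.2 * sphF p.1 ξ * (starRingEnd ℂ) (sphF p.2 ζ)) (K ξ ζ))
    (hsq : Summable fun p : ℕ × ℕ => ‖a p.1 p.2‖ ^ 2) :
    IsPosDefKer K ↔
      ∀ y : ℕ → ℂ, Memℓp y 2 →
        ∀ s : ℂ, HasSum (fun p : ℕ × ℕ => y p.1 * a p.1 p.2 * (starRingEnd ℂ) (y p.2)) s →
          0 ≤ s := by
  constructor
  · intro hK y _ s hs
    exact ge_of_tendsto' (hs.comp tendsto_range_product_range)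
      fun n => hK.sum_coeff_nonneg hcont hexp hsq y (Finset.range n)
  · intro h
    refine isPosDefKer_of_sum_coeff_nonneg hexp fun y n => ?_
    set u : ℕ → ℂ := fun m => if m < n then y m else 0 with hu
    have hmem : Memℓp u 2 := by
      refine (memℓp_zero ((Set.finite_lt_nat n).subset fun m hm => ?_)).of_exponent_ge zero_le
      by_contra hmn
      exact hm (if_neg hmn)
    refine h u hmem _ ?_
    have heq : ∑ p ∈ Finset.range n ×ˢ Finset.range n,
        y p.1 * a p.1 p.2 * (starRingEnd ℂ) (y p.2) =
        ∑ p ∈ Finset.range n ×ˢ Finset.range n,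
          u p.1 * a p.1 p.2 * (starRingEnd ℂ) (u p.2) := by
      refine Finset.sum_congr rfl fun p hp => ?_
      rw [Finset.mem_product, Finset.mem_range, Finset.mem_range] at hp
      simp only [hu, if_pos hp.1, if_pos hp.2]
    rw [heq]
    refine hasSum_sum_of_ne_finset_zero fun p hp => ?_
    rw [Finset.mem_product, Finset.mem_range, Finset.mem_range, not_and_or] at hp
    rcases hp with hp | hp <;> simp [hu, hp]

end
end

section
/- Let K be a continuous Hermitian kernel on S² × S² of the block form K(ξ,ζ) = Σ_{j=0}^∞ Σ_{k=−j}^{j} Σ_{k'=−j}^{j} d_j(k,k') Y_j^k(ξ) conj(Y_j^{k'}(ζ)), and let 𝓕 = { j ∈ ℕ : D_j is strictly positive }. If every D_j is positive, and if for every nonempty finite set Ξ of distinct points of S² and every c : Ξ → ℂ the implication [ Σ_{ξ∈Ξ} c_ξ Y_j^k(ξ) = 0 for all k = −j,…,j and all j ∈ 𝓕 ] ⇒ [ c_ξ = 0 for all ξ ∈ Ξ ] holds, then K is strictly positive definite. -/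
open scoped ComplexOrder
open Polynomial

noncomputable section

/-- Reindexing of a sum over the orders `-j ≤ k ≤ j` by `Fin (2 * j + 1)`. -/
theorem sum_Icc_neg_eq_sum_fin {M : Type*} [AddCommMonoid M] (j : ℕ) (f : ℤ → M) :
    ∑ k ∈ Finset.Icc (-(j : ℤ)) j, f k = ∑ i : Fin (2 * j + 1), f ((i : ℤ) - j) := by
  symm
  refine Finset.sum_bij (fun i _ => (i : ℤ) - j) ?_ ?_ ?_ ?_
  · intro i _
    have := i.isLt
    simp only [Finset.mem_Icc]
    omega
  · intro a _ b _ h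
    ext
    omega
  · intro k hk
    simp only [Finset.mem_Icc] at hk
    exact ⟨⟨(k + j).toNat, by omega⟩, Finset.mem_univ _, by simp only; omega⟩
  · intro i _
    rfl

/-- The quadratic form of one block, evaluated at the moments of `c`, is the quadratic
form of the matrix `D_j`. -/
theorem sum_block_eq_dotProduct (d : ℕ → ℤ → ℤ → ℂ) (j : ℕ) (Ξ : Finset S2) (c : S2 → ℂ) :
    ∑ ξ ∈ Ξ, ∑ ζ ∈ Ξ, c ξ * (starRingEnd ℂ) (c ζ) *
        ∑ k ∈ Finset.Icc (-(j : ℤ)) j, ∑ k' ∈ Finset.Icc (-(j : ℤ)) j,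
          d j k k' * sphY j k ξ * (starRingEnd ℂ) (sphY j k' ζ) =
      star (fun i : Fin (2 * j + 1) => star (∑ ξ ∈ Ξ, c ξ * sphY j ((i : ℤ) - j) ξ)) ⬝ᵥ
        (Dmat d j).mulVec
          (fun i : Fin (2 * j + 1) => star (∑ ξ ∈ Ξ, c ξ * sphY j ((i : ℤ) - j) ξ)) := by
  simp only [sum_Icc_neg_eq_sum_fin, dotProduct, Matrix.mulVec, Dmat, Pi.star_apply, star_star,
    star_sum, star_mul', Finset.mul_sum, Finset.sum_mul]
  simp_rw [Finset.sum_comm (s := Ξ) (t := Finset.univ)]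
  refine Finset.sum_congr rfl fun i _ => Finset.sum_congr rfl fun i' _ => ?_
  rw [Finset.sum_comm]
  refine Finset.sum_congr rfl fun ζ _ => Finset.sum_congr rfl fun ξ _ => ?_
  simp only [starRingEnd_apply]
  ring

/-- **Lemma 6.** Let `K` be a continuous Hermitian kernel with block expansion
coefficients `d_j(k,k')` such that every `D_j` is a positive operator, and let
`𝓕 = {j | D_j is strictly positive}`. If for every nonempty finite set `Ξ ⊆ S²` the
only coefficients `c` with `Σ_{ξ∈Ξ} c_ξ Y_j^k(ξ) = 0` for all `|k| ≤ j`, `j ∈ 𝓕`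
are `c ≡ 0`, then `K` is strictly positive definite. -/
theorem statement6 (K : S2 → S2 → ℂ) (d : ℕ → ℤ → ℤ → ℂ)
    (hcont : Continuous fun p : S2 × S2 => K p.1 p.2)
    (hherm : ∀ ξ ζ : S2, K ξ ζ = (starRingEnd ℂ) (K ζ ξ))
    (hexp : HasBlockExpansion K d)
    (hpos : ∀ j : ℕ, (Dmat d j).PosSemidef)
    (hind : ∀ Ξ : Finset S2, Ξ.Nonempty → ∀ c : S2 → ℂ,
      (∀ j : ℕ, (Dmat d j).PosDef →
        ∀ k ∈ Finset.Icc (-(j : ℤ)) (j : ℤ), ∑ ξ ∈ Ξ, c ξ * sphY j k ξ = 0) →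
      ∀ ξ ∈ Ξ, c ξ = 0) :
    IsStrictPosDefKer K := by
  intro Ξ hΞ c hc
  have hsum : HasSum (fun j : ℕ => ∑ ξ ∈ Ξ, ∑ ζ ∈ Ξ, c ξ * (starRingEnd ℂ) (c ζ) *
      ∑ k ∈ Finset.Icc (-(j : ℤ)) j, ∑ k' ∈ Finset.Icc (-(j : ℤ)) j,
        d j k k' * sphY j k ξ * (starRingEnd ℂ) (sphY j k' ζ))
      (∑ ξ ∈ Ξ, ∑ ζ ∈ Ξ, c ξ * (starRingEnd ℂ) (c ζ) * K ξ ζ) :=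
    hasSum_sum fun ξ _ => hasSum_sum fun ζ _ => (hexp ξ ζ).mul_left _
  simp only [sum_block_eq_dotProduct] at hsum
  obtain ⟨j, hj, k, hk, hne⟩ : ∃ j : ℕ, (Dmat d j).PosDef ∧
      ∃ k ∈ Finset.Icc (-(j : ℤ)) (j : ℤ), ∑ ξ ∈ Ξ, c ξ * sphY j k ξ ≠ 0 := by
    by_contra! h
    obtain ⟨ξ, hξ, hcξ⟩ := hc
    exact hcξ (hind Ξ hΞ c h ξ hξ)
  rw [Finset.mem_Icc] at hk
  refine lt_of_lt_of_le (hj.dotProduct_mulVec_pos fun h0 => hne ?_)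
    (le_hasSum hsum j fun i _ => (hpos i).dotProduct_mulVec_nonneg _)
  have h1 := congrFun h0 ⟨(k + j).toNat, by omega⟩
  have h2 : (((k + j).toNat : ℕ) : ℤ) - j = k := by omega
  simpa only [Pi.zero_apply, star_eq_zero, h2] using h1

end
end

section
/- Let K be a continuous kernel on S² × S² of the diagonal form K(ξ,ζ) = Σ_{j=0}^∞ Σ_{k=−j}^{j} a_{j,k} Y_j^k(ξ) conj(Y_j^k(ζ)) with real coefficients a_{j,k}. If a_{j,k} ≥ 0 for all j and k, and if for infinitely many even values of j and infinitely many odd values of j one has a_{j,k} > 0 for all k = −j,…,j, then K is strictly positive definite. -/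
open scoped ComplexOrder
open Polynomial

noncomputable section

/-- The coefficient of `X ^ n` in `(q + p X + X²) ^ j`. -/
def trinomCoeff {R : Type*} [CommRing R] (p q : R) (j n : ℕ) : R :=
  ((C q + C p * X + X ^ 2 : R[X]) ^ j).coeff n

section Trinomial

variable {R : Type*} [CommRing R] (p q : R)

lemma trinomCoeff_succ_add_two (j n : ℕ) :
    trinomCoeff p q (j + 1) (n + 2) =
      q * trinomCoeff p q j (n + 2) + p * trinomCoeff p q j (n + 1) + trinomCoeff p q j n := by
  unfold trinomCoeff
  rw [pow_succ', add_mul, add_mul, coeff_add, coeff_add, coeff_C_mul, mul_assoc, coeff_C_mul,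
    coeff_X_mul, coeff_X_pow_mul]

lemma trinomCoeff_succ_one (j : ℕ) :
    trinomCoeff p q (j + 1) 1 = q * trinomCoeff p q j 1 + p * trinomCoeff p q j 0 := by
  unfold trinomCoeff
  rw [pow_succ', add_mul, add_mul, coeff_add, coeff_add, coeff_C_mul, mul_assoc, coeff_C_mul,
    coeff_X_mul, coeff_X_pow_mul', if_neg (by norm_num), add_zero]

lemma trinomCoeff_succ_zero (j : ℕ) :
    trinomCoeff p q (j + 1) 0 = q * trinomCoeff p q j 0 := by
  unfold trinomCoeff
  rw [pow_succ', add_mul, add_mul, coeff_add, coeff_add, coeff_C_mul, mul_assoc, coeff_C_mul,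
    coeff_X_mul_zero, coeff_X_pow_mul', if_neg (by norm_num)]
  ring

lemma natDegree_trinom_pow_le (j : ℕ) :
    ((C q + C p * X + X ^ 2 : R[X]) ^ j).natDegree ≤ 2 * j := by
  have h : (C q + C p * X + X ^ 2 : R[X]).natDegree ≤ 2 := by compute_degree
  calc _ ≤ j * _ := natDegree_pow_le
    _ ≤ 2 * j := by nlinarith

lemma trinomCoeff_eq_zero {j n : ℕ} (h : 2 * j < n) : trinomCoeff p q j n = 0 :=
  coeff_eq_zero_of_natDegree_lt ((natDegree_trinom_pow_le p q j).trans_lt h)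

lemma trinomCoeff_sub (j : ℕ) : ∀ m ≤ j,
    trinomCoeff p q j (j - m) = q ^ m * trinomCoeff p q j (j + m) := by
  induction j with
  | zero => intro m hm; obtain rfl : m = 0 := by omega
            simp
  | succ j ih =>
    rintro (_ | m) hm
    · simp
    obtain ⟨i, rfl⟩ : ∃ i, j = i + m := ⟨j - m, by omega⟩
    have e0 := ih m (by omega)
    rw [show i + m + 1 - (m + 1) = i by omega, show i + m + 1 + (m + 1) = (i + m + m) + 2 by ring,
      trinomCoeff_succ_add_two]
    rw [show i + m - m = i by omega] at e0
    rcases i with _ | _ | i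
    · rw [trinomCoeff_succ_zero, e0, trinomCoeff_eq_zero (n := 0 + m + m + 2) p q (by omega),
        trinomCoeff_eq_zero (n := 0 + m + m + 1) p q (by omega)]
      ring
    · have e1 := ih (m + 1) (by omega)
      rw [show 0 + 1 + m - (m + 1) = 0 by omega] at e1
      rw [trinomCoeff_succ_one, e0, e1,
        trinomCoeff_eq_zero (n := 0 + 1 + m + m + 2) p q (by omega)]
      ring_nf
    · have e1 := ih (m + 1) (by omega)
      have e2 := ih (m + 2) (by omega)
      rw [show i + 1 + 1 + m - (m + 1) = i + 1 by omega] at e1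
      rw [show i + 1 + 1 + m - (m + 2) = i by omega] at e2
      rw [trinomCoeff_succ_add_two, e0, e1, e2]
      ring_nf

lemma trinomCoeff_zero_right_self (j : ℕ) : trinomCoeff p 0 j j = p ^ j := by
  have h : (C 0 + C p * X + X ^ 2 : R[X]) = (X + C p) * X := by rw [C_0]; ring
  unfold trinomCoeff
  rw [h, mul_pow]
  have := coeff_mul_X_pow ((X + C p : R[X]) ^ j) j 0
  rw [zero_add] at this
  rw [this, coeff_zero_eq_eval_zero]
  simp

lemma map_trinomCoeff {S : Type*} [CommRing S] (f : R →+* S) (j n : ℕ) :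
    f (trinomCoeff p q j n) = trinomCoeff (f p) (f q) j n := by
  unfold trinomCoeff
  rw [← coeff_map]
  simp

end Trinomial

/-- The expansion of `(p + A + B) ^ j` sorted by `A`-excess, in terms of `q = A B`. -/
lemma pow_add_add_eq_sum {F : Type*} [Field F] (p : F) {A B : F} (hAB : A = 0 → B = 0) (j : ℕ) :
    (p + A + B) ^ j = ∑ n ∈ Finset.range (2 * j + 1),
      if j ≤ n then trinomCoeff p (A * B) j n * A ^ (n - j)
      else trinomCoeff p (A * B) j (2 * j - n) * B ^ (j - n) := by
  have key : ∀ h : F, (A * B + p * h + h ^ 2) ^ j =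
      ∑ n ∈ Finset.range (2 * j + 1), trinomCoeff p (A * B) j n * h ^ n := by
    intro h
    have := eval_eq_sum_range' (Nat.lt_succ_of_le (natDegree_trinom_pow_le p (A * B) j)) h
    simp only [eval_pow, eval_add, eval_mul, eval_C, eval_X] at this
    exact this
  rcases eq_or_ne A 0 with hA | hA
  · rw [Finset.sum_eq_single j]
    · simp [hA, hAB hA, trinomCoeff_zero_right_self]
    · intro n _ hn
      split_ifs with h
      · rw [hA, zero_pow (by omega), mul_zero]
      · rw [hAB hA, zero_pow (by omega), mul_zero]
    · intro h
      exact absurd (Finset.mem_range.mpr (by omega)) h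
  · apply mul_left_cancel₀ (pow_ne_zero j hA)
    rw [← mul_pow, show A * (p + A + B) = A * B + p * A + A ^ 2 by ring, key, Finset.mul_sum]
    refine Finset.sum_congr rfl fun n hn => ?_
    have hn' : n < 2 * j + 1 := Finset.mem_range.mp hn
    split_ifs with h
    · obtain ⟨m, rfl⟩ := Nat.exists_eq_add_of_le h
      rw [Nat.add_sub_cancel_left, pow_add]
      ring
    · obtain ⟨m, rfl⟩ : ∃ m, j = n + m := ⟨j - n, by omega⟩
      have := trinomCoeff_sub p (A * B) (n + m) m (by omega)
      rw [Nat.add_sub_cancel] at this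
      rw [this, show 2 * (n + m) - n = n + m + m by omega, Nat.add_sub_cancel_left, mul_pow]
      ring

/-- Rodrigues' formula combined with Taylor's formula. -/
lemma trinomCoeff_eq_legP (z : ℝ) (j m : ℕ) :
    trinomCoeff (2 * z) (z ^ 2 - 1) j (j + m) =
      (2 ^ j * j.factorial / (j + m).factorial) * (derivative^[m] (legP j)).eval z := by
  have h : (C (z ^ 2 - 1) + C (2 * z) * X + X ^ 2 : ℝ[X]) ^ j = taylor z ((X ^ 2 - 1) ^ j) := by
    rw [taylor_pow]
    congr 1
    simp only [taylor_apply, sub_comp, pow_comp, X_comp, one_comp, C_sub, C_mul, C_pow, C_1,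
      map_ofNat]
    ring
  unfold trinomCoeff legP
  rw [h, taylor_coeff, iterate_derivative_C_mul, eval_C_mul, ← Function.iterate_add_apply,
    add_comm m j]
  have := congrArg (eval z) (congrFun (factorial_smul_hasseDeriv (R := ℝ) (j + m)) ((X ^ 2 - 1) ^ j))
  rw [← this]
  simp
  field_simp

/-- The first two coordinates of a point of the sphere as a complex number. -/
def planarPart (ξ : S2) : ℂ :=
  (((ξ : EuclideanSpace ℝ (Fin 3)) 0 : ℝ) : ℂ) +
    (((ξ : EuclideanSpace ℝ (Fin 3)) 1 : ℝ) : ℂ) * Complex.I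

lemma sum_sq_coord (ξ : S2) : (ξ : EuclideanSpace ℝ (Fin 3)) 0 ^ 2 +
    (ξ : EuclideanSpace ℝ (Fin 3)) 1 ^ 2 + (ξ : EuclideanSpace ℝ (Fin 3)) 2 ^ 2 = 1 := by
  have h : ‖(ξ : EuclideanSpace ℝ (Fin 3))‖ = 1 := by simp
  have h2 := EuclideanSpace.real_norm_sq_eq (ξ : EuclideanSpace ℝ (Fin 3))
  rw [h, Fin.sum_univ_three] at h2
  linarith

lemma norm_planarPart (ξ : S2) :
    ‖planarPart ξ‖ = Real.sqrt (1 - (ξ : EuclideanSpace ℝ (Fin 3)) 2 ^ 2) := by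
  rw [planarPart, Complex.norm_add_mul_I]
  congr 1
  linarith [sum_sq_coord ξ]

lemma planarPart_pow (ξ : S2) (m : ℕ) :
    planarPart ξ ^ m = (Real.sqrt (1 - (ξ : EuclideanSpace ℝ (Fin 3)) 2 ^ 2) : ℂ) ^ m *
      Complex.exp (Complex.I * (m : ℂ) * ((planarPart ξ).arg : ℂ)) := by
  conv_lhs => rw [← Complex.norm_mul_exp_arg_mul_I (planarPart ξ), norm_planarPart, mul_pow,
    ← Complex.exp_nat_mul]
  congr 2
  ring

lemma conj_planarPart_pow (ξ : S2) (m : ℕ) :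
    (starRingEnd ℂ) (planarPart ξ) ^ m =
      (Real.sqrt (1 - (ξ : EuclideanSpace ℝ (Fin 3)) 2 ^ 2) : ℂ) ^ m *
      Complex.exp (Complex.I * ((-m : ℤ) : ℂ) * ((planarPart ξ).arg : ℂ)) := by
  rw [← map_pow, planarPart_pow, map_mul, map_pow, Complex.conj_ofReal, ← Complex.exp_conj]
  congr 2
  simp

lemma planarPart_mul_conj (ξ : S2) :
    planarPart ξ * (starRingEnd ℂ) (planarPart ξ) =
      1 - (((ξ : EuclideanSpace ℝ (Fin 3)) 2 : ℝ) : ℂ) ^ 2 := by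
  rw [Complex.mul_conj, Complex.normSq_eq_norm_sq, norm_planarPart, Real.sq_sqrt]
  · push_cast; ring
  · nlinarith [sum_sq_coord ξ, sq_nonneg ((ξ : EuclideanSpace ℝ (Fin 3)) 0),
      sq_nonneg ((ξ : EuclideanSpace ℝ (Fin 3)) 1)]

lemma exists_sphY_natCast (j m : ℕ) : ∃ r : ℝ, r ≠ 0 ∧ ∀ ξ : S2, sphY j m ξ =
    (r : ℂ) * (((derivative^[m] (legP j)).eval ((ξ : EuclideanSpace ℝ (Fin 3)) 2) : ℝ) : ℂ) *
      planarPart ξ ^ m := by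
  refine ⟨1 / Real.sqrt (2 * Real.pi) * Real.sqrt ((2 * (j : ℝ) + 1) / 2 *
    ((((j : ℤ) - m).toNat.factorial : ℝ) / (((j : ℤ) + m).toNat.factorial : ℝ))) * (-1) ^ m,
    by positivity, fun ξ => ?_⟩
  rw [planarPart_pow, sphY, assocLeg, if_pos (by positivity), assocLegNat, ← planarPart]
  push_cast
  simp only [Int.toNat_natCast]
  ring

lemma exists_sphY_neg_natCast (j m : ℕ) (hm : m ≠ 0) : ∃ r : ℝ, r ≠ 0 ∧ ∀ ξ : S2,
    sphY j (-m) ξ =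
      (r : ℂ) * (((derivative^[m] (legP j)).eval ((ξ : EuclideanSpace ℝ (Fin 3)) 2) : ℝ) : ℂ) *
        (starRingEnd ℂ) (planarPart ξ) ^ m := by
  refine ⟨1 / Real.sqrt (2 * Real.pi) * Real.sqrt ((2 * (j : ℝ) + 1) / 2 *
    ((((j : ℤ) - -m).toNat.factorial : ℝ) / (((j : ℤ) + -m).toNat.factorial : ℝ))) *
      ((-1) ^ m * (((j - m).factorial : ℝ) / ((j + m).factorial : ℝ))) * (-1) ^ m,
    by positivity, fun ξ => ?_⟩
  rw [conj_planarPart_pow, sphY, assocLeg, if_neg (by omega), assocLegNat, ← planarPart]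
  push_cast
  simp only [Int.toNat_natCast, neg_neg]
  ring

/-- The span of the spherical harmonics `Y_j^k`, `-j ≤ k ≤ j`. -/
def harmonicSpan (j : ℕ) : Submodule ℂ (S2 → ℂ) :=
  Submodule.span ℂ ((fun k : ℤ => sphY j k) '' (Finset.Icc (-(j : ℤ)) j : Set ℤ))

lemma legP_mul_planarPart_mem (j m : ℕ) (hm : m ≤ j) :
    (fun ξ : S2 =>
      (((derivative^[m] (legP j)).eval ((ξ : EuclideanSpace ℝ (Fin 3)) 2) : ℝ) : ℂ) *
        planarPart ξ ^ m) ∈ harmonicSpan j := by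
  obtain ⟨r, hr, h⟩ := exists_sphY_natCast j m
  have hmem : sphY j m ∈ harmonicSpan j :=
    Submodule.subset_span ⟨m, by simp; omega, rfl⟩
  convert (harmonicSpan j).smul_mem (r : ℂ)⁻¹ hmem using 1
  funext ξ
  have : (r : ℂ) ≠ 0 := by exact_mod_cast hr
  rw [Pi.smul_apply, h, smul_eq_mul]
  field_simp

lemma legP_mul_conj_planarPart_mem (j m : ℕ) (hm : m ≤ j) (hm0 : m ≠ 0) :
    (fun ξ : S2 =>
      (((derivative^[m] (legP j)).eval ((ξ : EuclideanSpace ℝ (Fin 3)) 2) : ℝ) : ℂ) *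
        (starRingEnd ℂ) (planarPart ξ) ^ m) ∈ harmonicSpan j := by
  obtain ⟨r, hr, h⟩ := exists_sphY_neg_natCast j m hm0
  have hmem : sphY j (-m) ∈ harmonicSpan j :=
    Submodule.subset_span ⟨-m, by simp; omega, rfl⟩
  convert (harmonicSpan j).smul_mem (r : ℂ)⁻¹ hmem using 1
  funext ξ
  have : (r : ℂ) ≠ 0 := by exact_mod_cast hr
  rw [Pi.smul_apply, h, smul_eq_mul]
  field_simp

lemma trinomCoeff_ofReal (z : ℝ) (j m : ℕ) :
    trinomCoeff (2 * (z : ℂ)) ((z : ℂ) ^ 2 - 1) j (j + m) =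
      ((2 ^ j * j.factorial / (j + m).factorial : ℝ) : ℂ) *
        (((derivative^[m] (legP j)).eval z : ℝ) : ℂ) := by
  have h := congrArg Complex.ofRealHom (trinomCoeff_eq_legP z j m)
  rw [map_trinomCoeff] at h
  simpa using h

/-- Powers of isotropic linear forms are spherical harmonics. -/
lemma isotropic_pow_mem_harmonicSpan (j : ℕ) {u₀ u₁ u₂ : ℂ} (hu : u₀ ^ 2 + u₁ ^ 2 + u₂ ^ 2 = 0)
    (hu₂ : u₂ ≠ 0) :
    (fun ξ : S2 => (u₀ * (((ξ : EuclideanSpace ℝ (Fin 3)) 0 : ℝ) : ℂ) +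
      u₁ * (((ξ : EuclideanSpace ℝ (Fin 3)) 1 : ℝ) : ℂ) +
      u₂ * (((ξ : EuclideanSpace ℝ (Fin 3)) 2 : ℝ) : ℂ)) ^ j) ∈ harmonicSpan j := by
  set s := (u₀ - u₁ * Complex.I) / u₂ with hs
  set t := (u₀ + u₁ * Complex.I) / u₂ with ht
  have hst : s * t = -1 := by
    rw [hs, ht]
    field_simp
    linear_combination hu - u₁ ^ 2 * Complex.I_sq
  have hsum : (fun ξ : S2 => (u₀ * (((ξ : EuclideanSpace ℝ (Fin 3)) 0 : ℝ) : ℂ) +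
      u₁ * (((ξ : EuclideanSpace ℝ (Fin 3)) 1 : ℝ) : ℂ) +
      u₂ * (((ξ : EuclideanSpace ℝ (Fin 3)) 2 : ℝ) : ℂ)) ^ j) =
      (u₂ / 2) ^ j • ∑ n ∈ Finset.range (2 * j + 1), fun ξ : S2 =>
        if j ≤ n then
          trinomCoeff (2 * (((ξ : EuclideanSpace ℝ (Fin 3)) 2 : ℝ) : ℂ))
            ((((ξ : EuclideanSpace ℝ (Fin 3)) 2 : ℝ) : ℂ) ^ 2 - 1) j n *
            (s * planarPart ξ) ^ (n - j)
        else trinomCoeff (2 * (((ξ : EuclideanSpace ℝ (Fin 3)) 2 : ℝ) : ℂ))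
            ((((ξ : EuclideanSpace ℝ (Fin 3)) 2 : ℝ) : ℂ) ^ 2 - 1) j (2 * j - n) *
            (t * (starRingEnd ℂ) (planarPart ξ)) ^ (j - n) := by
    funext ξ
    have hAB : s * planarPart ξ = 0 → t * (starRingEnd ℂ) (planarPart ξ) = 0 := by
      intro h
      rcases mul_eq_zero.mp h with h | h
      · simp [h] at hst
      · simp [h]
    have hq : s * planarPart ξ * (t * (starRingEnd ℂ) (planarPart ξ)) =
        (((ξ : EuclideanSpace ℝ (Fin 3)) 2 : ℝ) : ℂ) ^ 2 - 1 := by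
      linear_combination planarPart ξ * (starRingEnd ℂ) (planarPart ξ) * hst -
        planarPart_mul_conj ξ
    have hp := pow_add_add_eq_sum (2 * (((ξ : EuclideanSpace ℝ (Fin 3)) 2 : ℝ) : ℂ)) hAB j
    rw [hq] at hp
    rw [Pi.smul_apply, Finset.sum_apply, ← hp, smul_eq_mul, ← mul_pow]
    congr 1
    rw [hs, ht, planarPart]
    simp only [map_add, map_mul, Complex.conj_ofReal, Complex.conj_I]
    field_simp
    linear_combination (2 * u₁ * (((ξ : EuclideanSpace ℝ (Fin 3)) 1 : ℝ) : ℂ)) * Complex.I_sq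
  rw [hsum]
  refine Submodule.smul_mem _ _ (Submodule.sum_mem _ fun n hn => ?_)
  have hn' : n < 2 * j + 1 := Finset.mem_range.mp hn
  by_cases h : j ≤ n
  · obtain ⟨m, rfl⟩ := Nat.exists_eq_add_of_le h
    convert (harmonicSpan j).smul_mem (((2 ^ j * j.factorial / (j + m).factorial : ℝ) : ℂ) * s ^ m)
      (legP_mul_planarPart_mem j m (by omega)) using 1
    funext ξ
    rw [if_pos h, trinomCoeff_ofReal, Nat.add_sub_cancel_left, Pi.smul_apply, smul_eq_mul, mul_pow]
    ring
  · obtain ⟨m, rfl⟩ : ∃ m, j = n + m := ⟨j - n, by omega⟩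
    convert (harmonicSpan (n + m)).smul_mem
      (((2 ^ (n + m) * (n + m).factorial / (n + m + m).factorial : ℝ) : ℂ) * t ^ m)
      (legP_mul_conj_planarPart_mem (n + m) m (by omega) (by omega)) using 1
    funext ξ
    rw [if_neg h, show 2 * (n + m) - n = n + m + m by omega, trinomCoeff_ofReal,
      Nat.add_sub_cancel_left, Pi.smul_apply, smul_eq_mul, mul_pow]
    ring

/-- Finitely many nonzero linear functionals on `ℝ³` have a common non-root with nonzero last
coordinate. -/
lemma exists_common_nonroot {ι : Type*} (S : Finset ι) (y : ι → Fin 3 → ℝ)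
    (hy : ∀ i ∈ S, y i ≠ 0) :
    ∃ v : Fin 3 → ℝ, v 2 ≠ 0 ∧ ∀ i ∈ S, v 0 * y i 0 + v 1 * y i 1 + v 2 * y i 2 ≠ 0 := by
  have hP : (X * ∏ i ∈ S, (C (y i 0) + C (y i 1) * X + C (y i 2) * X ^ 2) : ℝ[X]) ≠ 0 := by
    refine mul_ne_zero X_ne_zero (Finset.prod_ne_zero_iff.mpr fun i hi h => hy i hi ?_)
    funext k
    fin_cases k
    · simpa [coeff_X, coeff_C] using congrArg (fun p => coeff p 0) h
    · simpa [coeff_X, coeff_C] using congrArg (fun p => coeff p 1) h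
    · simpa [coeff_X, coeff_C] using congrArg (fun p => coeff p 2) h
  obtain ⟨t, ht⟩ : ∃ t : ℝ, eval t
      (X * ∏ i ∈ S, (C (y i 0) + C (y i 1) * X + C (y i 2) * X ^ 2) : ℝ[X]) ≠ 0 := by
    by_contra! h
    exact hP (Polynomial.funext fun t => by rw [h t, eval_zero])
  rw [eval_mul, eval_X, eval_prod] at ht
  have ht0 := left_ne_zero_of_mul ht
  refine ⟨![1, t, t ^ 2], by simpa using ht0, fun i hi => ?_⟩
  have := Finset.prod_ne_zero_iff.mp (right_ne_zero_of_mul ht) i hi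
  simp only [eval_add, eval_mul, eval_C, eval_X, eval_pow] at this
  simp only [Matrix.cons_val]
  convert this using 1
  ring

lemma S2_ext {ξ ζ : S2} (h₀ : (ξ : EuclideanSpace ℝ (Fin 3)) 0 = (ζ : EuclideanSpace ℝ (Fin 3)) 0)
    (h₁ : (ξ : EuclideanSpace ℝ (Fin 3)) 1 = (ζ : EuclideanSpace ℝ (Fin 3)) 1)
    (h₂ : (ξ : EuclideanSpace ℝ (Fin 3)) 2 = (ζ : EuclideanSpace ℝ (Fin 3)) 2) : ξ = ζ := by
  apply Subtype.ext
  ext k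
  fin_cases k <;> assumption

lemma eq_zero_of_sum_sq_eq_zero {x y z : ℝ} (h : x ^ 2 + y ^ 2 + z ^ 2 = 0) :
    x = 0 ∧ y = 0 ∧ z = 0 := by
  refine ⟨?_, ?_, ?_⟩ <;> nlinarith [sq_nonneg x, sq_nonneg y, sq_nonneg z]

/-- Points of the sphere with vanishing cross product are equal or antipodal. -/
lemma eq_or_eq_neg_of_cross_eq_zero {ξ ζ : S2}
    (h : crossProduct (fun i => (ξ : EuclideanSpace ℝ (Fin 3)) i)
      (fun i => (ζ : EuclideanSpace ℝ (Fin 3)) i) = 0) : ξ = ζ ∨ ξ = -ζ := by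
  rw [cross_apply] at h
  have h0 := congrFun h 0
  have h1 := congrFun h 1
  have h2 := congrFun h 2
  simp only [Matrix.cons_val, Pi.zero_apply] at h0 h1 h2
  have hξ := sum_sq_coord ξ
  have hζ := sum_sq_coord ζ
  have hneg : ∀ i, ((-ζ : S2) : EuclideanSpace ℝ (Fin 3)) i =
    -(ζ : EuclideanSpace ℝ (Fin 3)) i := fun i => rfl
  set a := (ξ : EuclideanSpace ℝ (Fin 3)) 0
  set b := (ξ : EuclideanSpace ℝ (Fin 3)) 1
  set c := (ξ : EuclideanSpace ℝ (Fin 3)) 2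
  set a' := (ζ : EuclideanSpace ℝ (Fin 3)) 0
  set b' := (ζ : EuclideanSpace ℝ (Fin 3)) 1
  set c' := (ζ : EuclideanSpace ℝ (Fin 3)) 2
  have hd : (a * a' + b * b' + c * c') ^ 2 = 1 := by
    linear_combination (a' ^ 2 + b' ^ 2 + c' ^ 2) * hξ + hζ - (b * c' - c * b') * h0 -
      (c * a' - a * c') * h1 - (a * b' - b * a') * h2
  rcases (sq_eq_sq_iff_eq_or_eq_neg.mp (hd.trans (one_pow 2).symm)) with hd | hd
  · obtain ⟨e0, e1, e2⟩ := eq_zero_of_sum_sq_eq_zero (x := a - a') (y := b - b')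
      (z := c - c') (by linear_combination hξ + hζ - 2 * hd)
    exact Or.inl (S2_ext (sub_eq_zero.mp e0) (sub_eq_zero.mp e1) (sub_eq_zero.mp e2))
  · obtain ⟨e0, e1, e2⟩ := eq_zero_of_sum_sq_eq_zero (x := a + a') (y := b + b')
      (z := c + c') (by linear_combination hξ + hζ + 2 * hd)
    exact Or.inr (S2_ext (eq_neg_of_add_eq_zero_left e0) (eq_neg_of_add_eq_zero_left e1)
      (eq_neg_of_add_eq_zero_left e2))

lemma exists_ne_zero_orthogonal (z : Fin 3 → ℝ) :
    ∃ w : Fin 3 → ℝ, w ≠ 0 ∧ w 0 * z 0 + w 1 * z 1 + w 2 * z 2 = 0 := by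
  by_cases h : z 2 = 0
  · exact ⟨![0, 0, 1], fun h' => by simpa using congrFun h' 2, by simp [h]⟩
  · refine ⟨![z 2, 0, -z 0], fun h' => h (by simpa using congrFun h' 0), ?_⟩
    simp only [Matrix.cons_val]
    ring

/-- Pythagoras for the decomposition of a unit vector `x` along a unit vector `z`, along the
component of `v` orthogonal to `z`, and along `z × v`. -/
lemma sq_add_sq_add_det_sq (z v x : Fin 3 → ℝ) (hz : z 0 ^ 2 + z 1 ^ 2 + z 2 ^ 2 = 1)
    (hx : x 0 ^ 2 + x 1 ^ 2 + x 2 ^ 2 = 1) {p q r V : ℝ}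
    (hp : p = z 0 * v 0 + z 1 * v 1 + z 2 * v 2) (hq : q = z 0 * x 0 + z 1 * x 1 + z 2 * x 2)
    (hr : r = v 0 * x 0 + v 1 * x 1 + v 2 * x 2) (hV : V = v 0 ^ 2 + v 1 ^ 2 + v 2 ^ 2) :
    (V - p ^ 2) * q ^ 2 + (r - p * q) ^ 2 + (v 0 * (x 1 * z 2 - x 2 * z 1) +
      v 1 * (x 2 * z 0 - x 0 * z 2) + v 2 * (x 0 * z 1 - x 1 * z 0)) ^ 2 = V - p ^ 2 := by
  subst hp hq hr hV
  linear_combination ((v 0 ^ 2 + v 1 ^ 2 + v 2 ^ 2) * (x 0 ^ 2 + x 1 ^ 2 + x 2 ^ 2) -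
    (v 0 * x 0 + v 1 * x 1 + v 2 * x 2) ^ 2) * hz +
    ((v 0 ^ 2 + v 1 ^ 2 + v 2 ^ 2) - (z 0 * v 0 + z 1 * v 1 + z 2 * v 2) ^ 2) * hx

/-- Every point `ζ` of the sphere admits an isotropic linear form which is `1` at `ζ` and has
modulus less than `1` at all given points other than `±ζ`. -/
lemma exists_isotropic_peak (Ξ : Finset S2) (ζ : S2) : ∃ u : Fin 3 → ℂ,
    u 0 ^ 2 + u 1 ^ 2 + u 2 ^ 2 = 0 ∧ u 2 ≠ 0 ∧
    u 0 * (((ζ : EuclideanSpace ℝ (Fin 3)) 0 : ℝ) : ℂ) +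
      u 1 * (((ζ : EuclideanSpace ℝ (Fin 3)) 1 : ℝ) : ℂ) +
      u 2 * (((ζ : EuclideanSpace ℝ (Fin 3)) 2 : ℝ) : ℂ) = 1 ∧
    ∀ ξ ∈ Ξ, ξ ≠ ζ → ξ ≠ -ζ →
      ‖u 0 * (((ξ : EuclideanSpace ℝ (Fin 3)) 0 : ℝ) : ℂ) +
        u 1 * (((ξ : EuclideanSpace ℝ (Fin 3)) 1 : ℝ) : ℂ) +
        u 2 * (((ξ : EuclideanSpace ℝ (Fin 3)) 2 : ℝ) : ℂ)‖ < 1 := by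
  classical
  set z : Fin 3 → ℝ := fun i => (ζ : EuclideanSpace ℝ (Fin 3)) i with hzdef
  have hz : z 0 ^ 2 + z 1 ^ 2 + z 2 ^ 2 = 1 := sum_sq_coord ζ
  obtain ⟨w, hw, hwz⟩ := exists_ne_zero_orthogonal z
  obtain ⟨v, hv₂, hv⟩ := exists_common_nonroot
    (insert w ((Ξ.filter fun ξ => ξ ≠ ζ ∧ ξ ≠ -ζ).image fun ξ : S2 =>
      crossProduct (fun i => (ξ : EuclideanSpace ℝ (Fin 3)) i) z)) id (by
    intro y hy
    rcases Finset.mem_insert.mp hy with rfl | hy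
    · exact hw
    · obtain ⟨ξ, hξ, rfl⟩ := Finset.mem_image.mp hy
      intro h
      exact (eq_or_eq_neg_of_cross_eq_zero h).elim (Finset.mem_filter.mp hξ).2.1
        (Finset.mem_filter.mp hξ).2.2)
  set p : ℝ := z 0 * v 0 + z 1 * v 1 + z 2 * v 2 with hp
  set V : ℝ := v 0 ^ 2 + v 1 ^ 2 + v 2 ^ 2 with hV
  have hsq : (v 0 - p * z 0) ^ 2 + (v 1 - p * z 1) ^ 2 + (v 2 - p * z 2) ^ 2 = V - p ^ 2 := by
    linear_combination p ^ 2 * hz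
  have hpos : 0 < V - p ^ 2 := by
    have hvw := hv w (Finset.mem_insert_self _ _)
    refine lt_of_le_of_ne (hsq ▸ by positivity) fun h => hvw ?_
    obtain ⟨h0, h1, h2⟩ := eq_zero_of_sum_sq_eq_zero (hsq.trans h.symm)
    simp only [id_eq]
    linear_combination w 0 * h0 + w 1 * h1 + w 2 * h2 + p * hwz
  obtain ⟨N, hN, hN2⟩ : ∃ N : ℝ, 0 < N ∧ N ^ 2 = V - p ^ 2 :=
    ⟨_, Real.sqrt_pos.mpr hpos, Real.sq_sqrt hpos.le⟩
  set b : Fin 3 → ℝ := fun i => (v i - p * z i) / N with hb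
  have hform : ∀ x : Fin 3 → ℝ, ((z 0 : ℂ) + b 0 * Complex.I) * (x 0 : ℂ) +
      ((z 1 : ℂ) + b 1 * Complex.I) * (x 1 : ℂ) + ((z 2 : ℂ) + b 2 * Complex.I) * (x 2 : ℂ) =
      ((z 0 * x 0 + z 1 * x 1 + z 2 * x 2 : ℝ) : ℂ) +
        ((b 0 * x 0 + b 1 * x 1 + b 2 * x 2 : ℝ) : ℂ) * Complex.I := by
    intro x
    push_cast
    ring
  have hbb : b 0 ^ 2 + b 1 ^ 2 + b 2 ^ 2 = 1 := by
    simp only [hb]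
    field_simp
    rw [hN2, hsq]
  have hbz : b 0 * z 0 + b 1 * z 1 + b 2 * z 2 = 0 := by
    simp only [hb]
    field_simp
    linear_combination -p * hz
  refine ⟨fun i => z i + b i * Complex.I, ?_, ?_, ?_, ?_⟩
  · have e1 := congrArg Complex.ofReal hz
    have e2 := congrArg Complex.ofReal hbb
    have e3 := congrArg Complex.ofReal hbz
    push_cast at e1 e2 e3
    linear_combination e1 + 2 * Complex.I * e3 - e2 +
      ((b 0 : ℂ) ^ 2 + (b 1 : ℂ) ^ 2 + (b 2 : ℂ) ^ 2) * Complex.I_sq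
  · intro h
    have hre := congrArg Complex.re h
    have him := congrArg Complex.im h
    simp at hre him
    apply hv₂
    simp only [hb, hre, mul_zero, sub_zero] at him
    exact (div_eq_zero_iff.mp him).resolve_right hN.ne'
  · refine (hform z).trans ?_
    rw [hbz, show z 0 * z 0 + z 1 * z 1 + z 2 * z 2 = 1 by linear_combination hz]
    simp
  · intro ξ hξ h1 h2
    set x : Fin 3 → ℝ := fun i => (ξ : EuclideanSpace ℝ (Fin 3)) i with hxdef
    have hx : x 0 ^ 2 + x 1 ^ 2 + x 2 ^ 2 = 1 := sum_sq_coord ξ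
    have hdet := hv (crossProduct x z) (Finset.mem_insert_of_mem (Finset.mem_image.mpr
      ⟨ξ, Finset.mem_filter.mpr ⟨hξ, h1, h2⟩, rfl⟩))
    rw [cross_apply] at hdet
    simp only [id_eq, Matrix.cons_val] at hdet
    have hpyth := sq_add_sq_add_det_sq z v x hz hx hp rfl rfl hV
    have hbx : N * (b 0 * x 0 + b 1 * x 1 + b 2 * x 2) =
        v 0 * x 0 + v 1 * x 1 + v 2 * x 2 - p * (z 0 * x 0 + z 1 * x 1 + z 2 * x 2) := by
      simp only [hb]
      field_simp
      ring
    rw [← hN2, ← hbx] at hpyth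
    refine lt_of_eq_of_lt (congrArg norm (hform x)) ?_
    rw [Complex.norm_add_mul_I, Real.sqrt_lt' one_pos]
    have hdet2 := sq_pos_of_ne_zero hdet
    generalize z 0 * x 0 + z 1 * x 1 + z 2 * x 2 = s at hpyth ⊢
    generalize b 0 * x 0 + b 1 * x 1 + b 2 * x 2 = t at hpyth ⊢
    by_contra! hcon
    linarith [mul_le_mul_of_nonneg_left hcon (sq_nonneg N)]

lemma eq_zero_of_frequently_annihilates {Ξ : Finset S2} {c : S2 → ℂ}
    (heven : {j : ℕ | Even j ∧ ∀ f ∈ harmonicSpan j, ∑ ξ ∈ Ξ, c ξ * f ξ = 0}.Infinite)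
    (hodd : {j : ℕ | Odd j ∧ ∀ f ∈ harmonicSpan j, ∑ ξ ∈ Ξ, c ξ * f ξ = 0}.Infinite) :
    ∀ ξ ∈ Ξ, c ξ = 0 := by
  classical
  intro ζ hζ
  obtain ⟨u, hu, hu₂, hpeak, hlt⟩ := exists_isotropic_peak Ξ ζ
  set ℓ : S2 → ℂ := fun ξ => u 0 * (((ξ : EuclideanSpace ℝ (Fin 3)) 0 : ℝ) : ℂ) +
        u 1 * (((ξ : EuclideanSpace ℝ (Fin 3)) 1 : ℝ) : ℂ) +
        u 2 * (((ξ : EuclideanSpace ℝ (Fin 3)) 2 : ℝ) : ℂ) with hℓ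
  have hneg : ℓ (-ζ) = -1 := by
    rw [← hpeak, hℓ]
    simp only [coe_neg_sphere, PiLp.neg_apply, Complex.ofReal_neg]
    ring
  have hne : ζ ≠ -ζ := fun h => by
    have h1 : ℓ ζ = -1 := by rw [h]; exact hneg
    rw [show ℓ ζ = 1 from hpeak] at h1
    norm_num at h1
  have lim : ∀ (ε : ℂ) (φ : ℕ → ℕ), StrictMono φ →
      (∀ i, (-1 : ℂ) ^ φ i = ε) →
      Filter.Tendsto (fun i => ∑ ξ ∈ Ξ, c ξ * ℓ ξ ^ φ i) Filter.atTop
        (nhds (∑ ξ ∈ Ξ, c ξ * ((if ξ = ζ then 1 else 0) + ε * (if ξ = -ζ then 1 else 0)))) := by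
    intro ε φ hφ hε
    refine tendsto_finsetSum _ fun ξ hξ => Filter.Tendsto.const_mul _ ?_
    by_cases h1 : ξ = ζ
    · subst h1
      rw [if_pos rfl, if_neg hne, show ℓ ξ = 1 from hpeak]
      simp
    by_cases h2 : ξ = -ζ
    · rw [if_neg h1, if_pos h2, h2, hneg]
      simp [hε]
    · rw [if_neg h1, if_neg h2, mul_zero, add_zero]
      exact (tendsto_pow_atTop_nhds_zero_of_norm_lt_one (hlt ξ hξ h1 h2)).comp hφ.tendsto_atTop
  have freq : ∀ φ : ℕ → ℕ, {j : ℕ | (∃ i, φ i = j) ∧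
        ∀ f ∈ harmonicSpan j, ∑ ξ ∈ Ξ, c ξ * f ξ = 0}.Infinite →
      ∃ᶠ i in Filter.atTop, ∑ ξ ∈ Ξ, c ξ * ℓ ξ ^ φ i ∈ ({0} : Set ℂ) := by
    intro φ hinf
    rw [Nat.frequently_atTop_iff_infinite]
    refine Set.Infinite.of_image φ (hinf.mono ?_)
    rintro j ⟨⟨i, rfl⟩, hi⟩
    exact ⟨i, hi _ (isotropic_pow_mem_harmonicSpan _ hu hu₂), rfl⟩
  have h0 := isClosed_singleton.mem_of_frequently_of_tendsto
    (freq (fun i => 2 * i) (heven.mono fun j hj => ⟨?_, hj.2⟩))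
    (lim 1 _ (fun a b h => by simpa using h) fun i => by simp [pow_mul])
  have h1 := isClosed_singleton.mem_of_frequently_of_tendsto
    (freq (fun i => 2 * i + 1) (hodd.mono fun j hj => ⟨?_, hj.2⟩))
    (lim (-1) _ (fun a b h => by simpa using h) fun i => by simp [pow_add, pow_mul])
  · rw [Set.mem_singleton_iff] at h0 h1
    have h2 := congrArg₂ (· + ·) h0 h1
    simp only [← Finset.sum_add_distrib, ← mul_add] at h2
    rw [Finset.sum_eq_single ζ (fun ξ _ h => by rw [if_neg h]; ring) (fun h => absurd hζ h),
      if_pos rfl] at h2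
    linear_combination h2 / 2
  · obtain ⟨k, rfl⟩ := hj.1
    exact ⟨k, rfl⟩
  · obtain ⟨k, rfl⟩ := hj.1
    exact ⟨k, two_mul k⟩

/-- **Proposition 2.** A continuous kernel of the diagonal form
`K(ξ,ζ) = Σ_j Σ_k a_{j,k} Y_j^k(ξ) conj(Y_j^k(ζ))` with real coefficients is
strictly positive definite if `a_{j,k} ≥ 0` always and `a_{j,k} > 0` for all
`k = -j,…,j` for infinitely many even and infinitely many odd values of `j`. -/
theorem statement10 (K : S2 → S2 → ℂ) (a : ℕ → ℤ → ℝ)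
    (hcont : Continuous fun p : S2 × S2 => K p.1 p.2)
    (hexp : ∀ ξ ζ : S2, HasSum (fun j : ℕ =>
      ∑ k ∈ Finset.Icc (-(j : ℤ)) (j : ℤ),
        (a j k : ℂ) * sphY j k ξ * (starRingEnd ℂ) (sphY j k ζ)) (K ξ ζ))
    (hnn : ∀ j : ℕ, ∀ k ∈ Finset.Icc (-(j : ℤ)) (j : ℤ), 0 ≤ a j k)
    (heven : {j : ℕ | Even j ∧ ∀ k ∈ Finset.Icc (-(j : ℤ)) (j : ℤ), 0 < a j k}.Infinite)
    (hodd : {j : ℕ | Odd j ∧ ∀ k ∈ Finset.Icc (-(j : ℤ)) (j : ℤ), 0 < a j k}.Infinite) :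
    IsStrictPosDefKer K := by

  intro Ξ _ c ⟨ξ₀, hξ₀, hc⟩
  set r : ℕ → ℝ := fun j => ∑ k ∈ Finset.Icc (-(j : ℤ)) (j : ℤ),
    a j k * Complex.normSq (∑ ξ ∈ Ξ, c ξ * sphY j k ξ) with hr
  have hterm : ∀ j : ℕ, ∀ k ∈ Finset.Icc (-(j : ℤ)) (j : ℤ),
      0 ≤ a j k * Complex.normSq (∑ ξ ∈ Ξ, c ξ * sphY j k ξ) := fun j k hk =>
    mul_nonneg (hnn j k hk) (Complex.normSq_nonneg _)
  have hr0 : ∀ j, 0 ≤ r j := fun j => Finset.sum_nonneg (hterm j)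
  have hsum : HasSum (fun j => (r j : ℂ))
      (∑ ξ ∈ Ξ, ∑ ζ ∈ Ξ, c ξ * (starRingEnd ℂ) (c ζ) * K ξ ζ) := by
    have hterms : ∀ j : ℕ, (r j : ℂ) = ∑ ξ ∈ Ξ, ∑ ζ ∈ Ξ, c ξ * (starRingEnd ℂ) (c ζ) *
        ∑ k ∈ Finset.Icc (-(j : ℤ)) (j : ℤ),
          (a j k : ℂ) * sphY j k ξ * (starRingEnd ℂ) (sphY j k ζ) := by
      intro j
      simp only [hr, Complex.ofReal_sum, Complex.ofReal_mul, ← Complex.mul_conj, map_sum, map_mul,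
        Finset.sum_mul_sum]
      simp only [Finset.mul_sum]
      rw [Finset.sum_comm (s := Finset.Icc _ _)]
      refine Finset.sum_congr rfl fun ξ _ => ?_
      rw [Finset.sum_comm (s := Finset.Icc _ _)]
      refine Finset.sum_congr rfl fun ζ _ => Finset.sum_congr rfl fun k _ => ?_
      ring
    rw [funext hterms]
    exact hasSum_sum fun ξ _ => hasSum_sum fun ζ _ =>
      (hexp ξ ζ).mul_left (c ξ * (starRingEnd ℂ) (c ζ))
  obtain ⟨t, ht⟩ : ∃ t : ℝ, (t : ℂ) = ∑ ξ ∈ Ξ, ∑ ζ ∈ Ξ, c ξ * (starRingEnd ℂ) (c ζ) * K ξ ζ :=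
    ⟨_, (Complex.hasSum_ofReal.mpr (Complex.hasSum_re hsum)).unique hsum⟩
  rw [← ht] at hsum ⊢
  have hsum' : HasSum r t := Complex.hasSum_ofReal.mp hsum
  have ht0 : 0 ≤ t := hsum'.nonneg hr0
  rcases ht0.lt_or_eq with h | rfl
  · exact_mod_cast h
  have hzero : ∀ j, r j = 0 := fun j =>
    congrFun ((hasSum_zero_iff_of_nonneg hr0).mp hsum') j
  have hann : ∀ j : ℕ, (∀ k ∈ Finset.Icc (-(j : ℤ)) (j : ℤ), 0 < a j k) →
      ∀ f ∈ harmonicSpan j, ∑ ξ ∈ Ξ, c ξ * f ξ = 0 := by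
    intro j hj f hf
    induction hf using Submodule.span_induction with
    | mem f hf =>
      obtain ⟨k, hk, rfl⟩ := hf
      have h := (Finset.sum_eq_zero_iff_of_nonneg (hterm j)).mp (hzero j) k hk
      exact Complex.normSq_eq_zero.mp ((mul_eq_zero.mp h).resolve_left (hj k hk).ne')
    | zero => simp
    | add f g _ _ hf hg => simp [mul_add, Finset.sum_add_distrib, hf, hg]
    | smul z f _ hf =>
      simp only [Pi.smul_apply, smul_eq_mul, mul_left_comm _ z, ← Finset.mul_sum, hf, mul_zero]
  exact absurd (eq_zero_of_frequently_annihilates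
    (heven.mono fun j hj => ⟨hj.1, hann j hj.2⟩)
    (hodd.mono fun j hj => ⟨hj.1, hann j hj.2⟩) ξ₀ hξ₀) hc

end
end

section
/- Let Ξ be a nonempty finite set of distinct points of S² and c : Ξ → ℂ. If Σ_{ξ∈Ξ} c_ξ Y_j^k(ξ) = 0 for every j ∈ ℕ and every k with −j ≤ k ≤ j, then c_ξ = 0 for all ξ ∈ Ξ. -/
open scoped ComplexOrder
open Polynomial

noncomputable section

theorem degree_iterate_derivative_eq {R : Type*} [Semiring R] [IsAddTorsionFree R]
    {p : R[X]} {m n : ℕ} (hp : p.degree = ((m + n : ℕ) : WithBot ℕ)) :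
    (derivative^[m] p).degree = (n : WithBot ℕ) := by
  induction m generalizing p with
  | zero => simpa using hp
  | succ m ih =>
    have hd : p.natDegree = m + 1 + n := natDegree_eq_of_degree_eq_some hp
    rw [Function.iterate_succ_apply]
    apply ih
    rw [degree_derivative (by omega), hd]
    congr 1
    omega

theorem degree_legP (j : ℕ) : (legP j).degree = (j : WithBot ℕ) := by
  have hc : (1 / ((2 : ℝ) ^ j * (j.factorial : ℝ))) ≠ 0 := by positivity
  have hX : ((X : ℝ[X]) ^ 2 - 1).degree = ((2 : ℕ) : WithBot ℕ) := by
    simpa using degree_X_pow_sub_C (R := ℝ) (n := 2) (by norm_num) 1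
  have hdeg : (((X : ℝ[X]) ^ 2 - 1) ^ j).degree = ((j + j : ℕ) : WithBot ℕ) := by
    rw [degree_pow, hX, ← mul_two, nsmul_eq_mul]
    norm_cast
  rw [legP, degree_C_mul hc, degree_iterate_derivative_eq hdeg]

/-- The `m`-th derivatives of the Legendre polynomials of degree at least `m`. -/
def legDerivSeq (m : ℕ) : Polynomial.Sequence ℝ where
  elems' n := derivative^[m] (legP (m + n))
  degree_eq' n := degree_iterate_derivative_eq (degree_legP (m + n))

theorem span_legDerivSeq (m : ℕ) :
    Submodule.span ℝ (Set.range (legDerivSeq m)) = ⊤ :=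
  (legDerivSeq m).span fun n => by simp [(legDerivSeq m).ne_zero n]

/-- The horizontal coordinates of a point of the sphere, as the complex number `ξ₁ + i ξ₂`. -/
def horiz (ξ : S2) : ℂ :=
  (((ξ : EuclideanSpace ℝ (Fin 3)) 0 : ℝ) : ℂ) +
    (((ξ : EuclideanSpace ℝ (Fin 3)) 1 : ℝ) : ℂ) * Complex.I

theorem sqrt_one_sub_sq_eq_norm_horiz (ξ : S2) :
    Real.sqrt (1 - (ξ : EuclideanSpace ℝ (Fin 3)) 2 ^ 2) = ‖horiz ξ‖ := by
  have hξ : ‖(ξ : EuclideanSpace ℝ (Fin 3))‖ ^ 2 = 1 := by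
    rw [mem_sphere_zero_iff_norm.mp ξ.2, one_pow]
  rw [EuclideanSpace.real_norm_sq_eq, Fin.sum_univ_three] at hξ
  rw [horiz, Complex.norm_add_mul_I]
  congr 1
  linarith

theorem horiz_and_height_injective {ξ ζ : S2} (hw : horiz ξ = horiz ζ)
    (hz : (ξ : EuclideanSpace ℝ (Fin 3)) 2 = (ζ : EuclideanSpace ℝ (Fin 3)) 2) : ξ = ζ := by
  have h0 := congrArg Complex.re hw
  have h1 := congrArg Complex.im hw
  simp only [horiz, Complex.add_re, Complex.add_im, Complex.mul_re, Complex.mul_im,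
    Complex.ofReal_re, Complex.ofReal_im, Complex.I_re, Complex.I_im] at h0 h1
  ext i
  fin_cases i
  · simpa using h0
  · simpa using h1
  · exact hz

/-- Up to a nonzero factor, `Y_{m+n}^m(ξ) = (ξ₁ + i ξ₂)^m P_{m+n}^{(m)}(ξ₃)`. -/
theorem exists_sphY_eq (m n : ℕ) : ∃ a : ℂ, a ≠ 0 ∧ ∀ ξ : S2,
    sphY (m + n) m ξ = a * (horiz ξ ^ m *
      (((legDerivSeq m n).eval ((ξ : EuclideanSpace ℝ (Fin 3)) 2) : ℝ) : ℂ)) := by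
  refine ⟨((1 / Real.sqrt (2 * Real.pi) *
      Real.sqrt ((2 * ((m + n : ℕ) : ℝ) + 1) / 2 *
        (((((m + n : ℕ) : ℤ) - (m : ℤ)).toNat.factorial : ℝ) /
          ((((m + n : ℕ) : ℤ) + (m : ℤ)).toNat.factorial : ℝ))) * (-1) ^ m : ℝ) : ℂ), ?_, ?_⟩
  · rw [Complex.ofReal_ne_zero]
    positivity
  · intro ξ
    have hw : horiz ξ ^ m = ((‖horiz ξ‖ : ℝ) : ℂ) ^ m *
        Complex.exp (Complex.I * (m : ℂ) * ((Complex.arg (horiz ξ) : ℝ) : ℂ)) := by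
      conv_lhs => rw [← Complex.norm_mul_exp_arg_mul_I (horiz ξ), mul_pow, ← Complex.exp_nat_mul]
      congr 2
      ring
    rw [hw]
    simp only [sphY, assocLeg, Int.natCast_nonneg, if_true, Int.toNat_natCast, assocLegNat,
      sqrt_one_sub_sq_eq_norm_horiz, Int.cast_natCast]
    rw [← horiz]
    change _ = _ * (_ * (((derivative^[m] (legP (m + n))).eval _ : ℝ) : ℂ))
    push_cast
    ring

section Separation

variable {Ξ : Finset S2} {c : S2 → ℂ}

theorem sum_horiz_pow_mul_eval_eq_zero
    (h : ∀ j : ℕ, ∀ k ∈ Finset.Icc (-(j : ℤ)) (j : ℤ), ∑ ξ ∈ Ξ, c ξ * sphY j k ξ = 0)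
    (m : ℕ) (q : ℝ[X]) :
    ∑ ξ ∈ Ξ, c ξ * (horiz ξ ^ m *
      ((q.eval ((ξ : EuclideanSpace ℝ (Fin 3)) 2) : ℝ) : ℂ)) = 0 := by
  have hq : q ∈ Submodule.span ℝ (Set.range (legDerivSeq m)) := by
    rw [span_legDerivSeq]
    exact Submodule.mem_top
  induction hq using Submodule.span_induction with
  | mem q hq =>
    obtain ⟨n, rfl⟩ := hq
    obtain ⟨a, ha, hY⟩ := exists_sphY_eq m n
    have hs := h (m + n) m (Finset.mem_Icc.mpr ⟨by omega, by omega⟩)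
    simp only [hY, mul_left_comm _ a] at hs
    rw [← Finset.mul_sum] at hs
    exact (mul_eq_zero.mp hs).resolve_left ha
  | zero => simp
  | add p q _ _ hp hq =>
    simp only [eval_add, Complex.ofReal_add, mul_add, Finset.sum_add_distrib, hp, hq, add_zero]
  | smul r q _ hq =>
    simp only [eval_smul, smul_eq_mul, Complex.ofReal_mul, mul_left_comm _ (r : ℂ)]
    rw [← Finset.mul_sum, hq, mul_zero]

theorem sum_eval_horiz_mul_eval_eq_zero
    (h : ∀ j : ℕ, ∀ k ∈ Finset.Icc (-(j : ℤ)) (j : ℤ), ∑ ξ ∈ Ξ, c ξ * sphY j k ξ = 0)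
    (p : ℂ[X]) (q : ℝ[X]) :
    ∑ ξ ∈ Ξ, c ξ * (p.eval (horiz ξ) *
      ((q.eval ((ξ : EuclideanSpace ℝ (Fin 3)) 2) : ℝ) : ℂ)) = 0 := by
  induction p using Polynomial.induction_on' with
  | add p₁ p₂ h₁ h₂ =>
    simp only [eval_add, add_mul, mul_add, Finset.sum_add_distrib, h₁, h₂, add_zero]
  | monomial m a =>
    simp only [eval_monomial, mul_assoc, mul_left_comm _ a]
    rw [← Finset.mul_sum, sum_horiz_pow_mul_eval_eq_zero h, mul_zero]

end Separation

/-- A polynomial vanishing at every value of `f` on a finite set other than `a`, but not at `a`. -/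
theorem exists_separating_polynomial {R α : Type*} [Field R] (s : Finset α) (f : α → R) (a : R) :
    ∃ p : R[X], p.eval a ≠ 0 ∧ ∀ x ∈ s, f x ≠ a → p.eval (f x) = 0 := by
  classical
  refine ⟨∏ x ∈ s.filter (fun x => f x ≠ a), (X - C (f x)), ?_, ?_⟩
  · rw [eval_prod, Finset.prod_ne_zero_iff]
    intro x hx
    simpa [sub_eq_zero] using (Finset.mem_filter.mp hx).2.symm
  · intro x hx hxa
    rw [eval_prod]
    exact Finset.prod_eq_zero (Finset.mem_filter.mpr ⟨hx, hxa⟩) (by simp)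

/-- The point-evaluation vectors of the spherical harmonics at finitely many
distinct points of the sphere are linearly independent: if
`Σ_{ξ∈Ξ} c_ξ Y_j^k(ξ) = 0` for every `j ∈ ℕ` and every `k` with `-j ≤ k ≤ j`,
then `c ≡ 0` on `Ξ`. -/
theorem statement11 (Ξ : Finset S2) (hne : Ξ.Nonempty) (c : S2 → ℂ)
    (h : ∀ j : ℕ, ∀ k ∈ Finset.Icc (-(j : ℤ)) (j : ℤ),
      ∑ ξ ∈ Ξ, c ξ * sphY j k ξ = 0) :
    ∀ ξ ∈ Ξ, c ξ = 0 := by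
  intro ξ hξ
  obtain ⟨p, hp, hp'⟩ := exists_separating_polynomial Ξ horiz (horiz ξ)
  obtain ⟨q, hq, hq'⟩ := exists_separating_polynomial Ξ
    (fun ζ : S2 => (ζ : EuclideanSpace ℝ (Fin 3)) 2) ((ξ : EuclideanSpace ℝ (Fin 3)) 2)
  have hs := sum_eval_horiz_mul_eval_eq_zero h p q
  rw [Finset.sum_eq_single_of_mem ξ hξ] at hs
  · exact (mul_eq_zero.mp hs).resolve_right
      (mul_ne_zero hp (Complex.ofReal_ne_zero.mpr hq))
  · intro ζ hζ hne
    by_cases hw : horiz ζ = horiz ξ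
    · have hz : (ζ : EuclideanSpace ℝ (Fin 3)) 2 ≠ (ξ : EuclideanSpace ℝ (Fin 3)) 2 :=
        fun hz => hne (horiz_and_height_injective hw hz)
      rw [hq' ζ hζ hz]
      simp
    · rw [hp' ζ hζ hw]
      simp

end
end
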